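/- arXiv:2101.01545 — 4 statements merged into one kernel-verified Lean document; each statement's English description precedes it below -/
import Mathlib

section
/- Let 0 < α < n, let Φ, Ψ be Orlicz functions, and let either 0 < λ, μ < 1 with λ ≠ μ, or λ = μ = 0. Assume there exist constants C₄, C₅ ≥ 1 such that ∫_u^∞ t^{α/n} Φ⁻¹(t^{λ−1}) dt/t ≤ C₄ Ψ⁻¹(u^{μ−1}) for all u > 0, and ∫_u^∞ t^{α/n} Φ⁻¹(r^λ/t) dt/t ≤ C₅ Ψ⁻¹(r^μ/u) for all u > 0 and all r > 0. Then the Riesz potential I_α is bounded from M^{Φ,λ}(0) to the weak space WM^{Ψ,μ}(0): there exists a constant c₆ ≥ 1 such that ‖I_α f‖_{WM^{Ψ,μ}(0)} ≤ c₆ ‖f‖_{M^{Φ,λ}(0)} for all f ∈ M^{Φ,λ}(0). -/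
open MeasureTheory Metric Set Filter ENNReal NNReal Topology

noncomputable section

/-- ℝⁿ as Euclidean space. -/
abbrev Eu (n : ℕ) : Type := EuclideanSpace ℝ (Fin n)

/-- The (right-continuous) generalized inverse `Φ⁻¹(v) = inf {u ≥ 0 : Φ(u) > v}`
(with `inf ∅ = ∞`). -/
def yInv (Φ : ℝ≥0∞ → ℝ≥0∞) (v : ℝ≥0∞) : ℝ≥0∞ := sInf {u : ℝ≥0∞ | v < Φ u}

/-- The complementary (conjugate) function `Φ*(v) = sup_{u > 0} (u⬝v − Φ(u))`. -/
def yConj (Φ : ℝ≥0∞ → ℝ≥0∞) (v : ℝ≥0∞) : ℝ≥0∞ :=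
  ⨆ (u : ℝ≥0∞) (_ : 0 < u) (_ : u ≠ ∞), u * v - Φ u

/-- The dilation function `s_{Φ⁻¹}(t) = sup_{s > 0} Φ⁻¹(st)/Φ⁻¹(s)`. -/
def sDil (Φ : ℝ≥0∞ → ℝ≥0∞) (t : ℝ≥0∞) : ℝ≥0∞ :=
  ⨆ (s : ℝ≥0∞) (_ : 0 < s) (_ : s ≠ ∞), yInv Φ (s * t) / yInv Φ s

/-- A Young function: nondecreasing, convex, `Φ(0) = 0 = lim_{u→0+} Φ(u)`, not identically
`0` nor `∞` on `(0,∞)`, and left continuous (values in `[0,∞]`, the value at `∞` being the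
canonical/limit extension). -/
structure IsYoungFn (Φ : ℝ≥0∞ → ℝ≥0∞) : Prop where
  mono : Monotone Φ
  map_zero : Φ 0 = 0
  tendsto_zero : Filter.Tendsto Φ (nhdsWithin 0 (Set.Ioi 0)) (nhds 0)
  convex : ∀ a b t : ℝ≥0∞, t ≤ 1 → Φ (t * a + (1 - t) * b) ≤ t * Φ a + (1 - t) * Φ b
  not_zero : ∃ u : ℝ≥0∞, 0 < u ∧ u ≠ ∞ ∧ Φ u ≠ 0
  not_top : ∃ u : ℝ≥0∞, 0 < u ∧ u ≠ ∞ ∧ Φ u ≠ ∞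
  left_cont : ∀ u : ℝ≥0∞, 0 < u → Filter.Tendsto Φ (nhdsWithin u (Set.Iio u)) (nhds (Φ u))

/-- An Orlicz function: increasing, continuous, convex, `Φ(0) = 0`, finite on `[0,∞)`
(the value at `∞` being the canonical extension `Φ(∞) = ∞`). -/
structure IsOrliczFn (Φ : ℝ≥0∞ → ℝ≥0∞) : Prop where
  map_zero : Φ 0 = 0
  strictMono : StrictMono Φ
  continuous : Continuous Φ
  convex : ∀ a b t : ℝ≥0∞, t ≤ 1 → Φ (t * a + (1 - t) * b) ≤ t * Φ a + (1 - t) * Φ b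
  finite : ∀ u : ℝ≥0∞, u ≠ ∞ → Φ u ≠ ∞
  map_top : Φ ∞ = ∞

/-- The Δ₂-condition: `0 < Φ(u) < ∞` for `0 < u < ∞` and `Φ(2u) ≤ D₂ Φ(u)` for some `D₂ ≥ 1`. -/
def IsDelta2 (Φ : ℝ≥0∞ → ℝ≥0∞) : Prop :=
  (∀ u : ℝ≥0∞, 0 < u → u ≠ ∞ → 0 < Φ u ∧ Φ u ≠ ∞) ∧
    ∃ D : ℝ≥0∞, 1 ≤ D ∧ D ≠ ∞ ∧ ∀ u : ℝ≥0∞, u ≠ ∞ → Φ (2 * u) ≤ D * Φ u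

/-- The Luxemburg-type functional `‖f‖_{Φ,λ,A}`. -/
def orliczNorm {n : ℕ} (Φ : ℝ≥0∞ → ℝ≥0∞) (lam : ℝ) (A : Set (Eu n)) (f : Eu n → ℝ) : ℝ≥0∞ :=
  sInf {ε : ℝ≥0∞ | 0 < ε ∧ ε ≠ ∞ ∧
    volume A ^ (-lam) * ∫⁻ x in A, Φ ((‖f x‖₊ : ℝ≥0∞) / ε) ≤ 1}

/-- The weak Luxemburg-type functional `‖f‖_{Φ,λ,A,∞}`. -/
def orliczWeakNorm {n : ℕ} (Φ : ℝ≥0∞ → ℝ≥0∞) (lam : ℝ) (A : Set (Eu n)) (f : Eu n → ℝ) : ℝ≥0∞ :=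
  sInf {ε : ℝ≥0∞ | 0 < ε ∧ ε ≠ ∞ ∧
    (⨆ (u : ℝ≥0) (_ : 0 < u),
      Φ ((u : ℝ≥0∞) / ε) * (volume A ^ (-lam) * volume {x ∈ A | u < ‖f x‖₊})) ≤ 1}

/-- The central Morrey–Orlicz norm `‖f‖_{M^{Φ,λ}(0)} = sup_{r>0} ‖f‖_{Φ,λ,B_r}`. -/
def centralNorm {n : ℕ} (Φ : ℝ≥0∞ → ℝ≥0∞) (lam : ℝ) (f : Eu n → ℝ) : ℝ≥0∞ :=
  ⨆ (r : ℝ) (_ : 0 < r), orliczNorm Φ lam (ball (0 : Eu n) r) f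

/-- The weak central Morrey–Orlicz norm `‖f‖_{WM^{Φ,λ}(0)} = sup_{r>0} ‖f‖_{Φ,λ,B_r,∞}`. -/
def centralWeakNorm {n : ℕ} (Φ : ℝ≥0∞ → ℝ≥0∞) (lam : ℝ) (f : Eu n → ℝ) : ℝ≥0∞ :=
  ⨆ (r : ℝ) (_ : 0 < r), orliczWeakNorm Φ lam (ball (0 : Eu n) r) f

/-- The Riesz potential `I_α f(x) = ∫ f(y) |x−y|^{α−n} dy`. -/
def riesz {n : ℕ} (α : ℝ) (f : Eu n → ℝ) (x : Eu n) : ℝ :=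
  ∫ y, f y / ‖x - y‖ ^ ((n : ℝ) - α)

/-- The classical Morrey norm `‖f‖_{M^{p,λ}}`. -/
def morreyNormP {n : ℕ} (p lam : ℝ) (f : Eu n → ℝ) : ℝ≥0∞ :=
  ⨆ (x₀ : Eu n) (r : ℝ) (_ : 0 < r),
    (volume (ball x₀ r) ^ (-lam) * ∫⁻ x in ball x₀ r, (‖f x‖₊ : ℝ≥0∞) ^ p) ^ (1 / p)

/-- The classical central Morrey norm `‖f‖_{M^{p,λ}(0)}`. -/
def centralNormP {n : ℕ} (p lam : ℝ) (f : Eu n → ℝ) : ℝ≥0∞ :=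
  ⨆ (r : ℝ) (_ : 0 < r),
    (volume (ball (0 : Eu n) r) ^ (-lam) * ∫⁻ x in ball (0 : Eu n) r, (‖f x‖₊ : ℝ≥0∞) ^ p) ^ (1 / p)


theorem IsOrliczFn.yInv_apply {Φ : ℝ≥0∞ → ℝ≥0∞} (hΦ : IsOrliczFn Φ) (a : ℝ≥0∞) :
    yInv Φ (Φ a) = a := by
  refine le_antisymm (le_of_forall_gt_imp_ge_of_dense fun c hc => sInf_le (hΦ.strictMono hc)) ?_
  exact le_sInf fun c hc => (hΦ.strictMono.lt_iff_lt.1 hc).le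

theorem IsOrliczFn.surjective {Φ : ℝ≥0∞ → ℝ≥0∞} (hΦ : IsOrliczFn Φ) :
    Function.Surjective Φ := fun v => by
  obtain ⟨a, -, ha⟩ := intermediate_value_Icc (zero_le (a := (∞ : ℝ≥0∞))) hΦ.continuous.continuousOn
    (show v ∈ Icc (Φ 0) (Φ ∞) by simp [hΦ.map_zero, hΦ.map_top])
  exact ⟨a, ha⟩

theorem IsOrliczFn.apply_yInv {Φ : ℝ≥0∞ → ℝ≥0∞} (hΦ : IsOrliczFn Φ) (v : ℝ≥0∞) :
    Φ (yInv Φ v) = v := by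
  obtain ⟨a, rfl⟩ := hΦ.surjective v
  rw [hΦ.yInv_apply]

theorem yInv_mono (Φ : ℝ≥0∞ → ℝ≥0∞) : Monotone (yInv Φ) :=
  fun _ _ h => sInf_le_sInf fun _ hu => lt_of_le_of_lt h hu

theorem IsOrliczFn.apply_ne_zero {Φ : ℝ≥0∞ → ℝ≥0∞} (hΦ : IsOrliczFn Φ) {a : ℝ≥0∞} (ha : a ≠ 0) :
    Φ a ≠ 0 := by
  rw [← hΦ.map_zero]
  exact hΦ.strictMono.injective.ne ha

theorem IsOrliczFn.yInv_ne_zero {Φ : ℝ≥0∞ → ℝ≥0∞} (hΦ : IsOrliczFn Φ) {v : ℝ≥0∞} (hv : v ≠ 0) :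
    yInv Φ v ≠ 0 := fun h => hv (by rw [← hΦ.apply_yInv v, h, hΦ.map_zero])

theorem IsOrliczFn.yInv_ne_top {Φ : ℝ≥0∞ → ℝ≥0∞} (hΦ : IsOrliczFn Φ) {v : ℝ≥0∞} (hv : v ≠ ∞) :
    yInv Φ v ≠ ∞ := fun h => hv (by rw [← hΦ.apply_yInv v, h, hΦ.map_top])

theorem IsOrliczFn.apply_mul_le {Φ : ℝ≥0∞ → ℝ≥0∞} (hΦ : IsOrliczFn Φ) {t : ℝ≥0∞} (ht : t ≤ 1)
    (a : ℝ≥0∞) : Φ (t * a) ≤ t * Φ a := by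
  simpa [hΦ.map_zero] using hΦ.convex a 0 t ht

theorem IsOrliczFn.mul_apply_div_le {Φ : ℝ≥0∞ → ℝ≥0∞} (hΦ : IsOrliczFn Φ) {c : ℝ≥0∞} (hc : 1 ≤ c)
    (hc' : c ≠ ∞) (a : ℝ≥0∞) : c * Φ (a / c) ≤ Φ a := by
  have h := hΦ.apply_mul_le (ENNReal.inv_le_one.2 hc) a
  have hc0 : c ≠ 0 := (zero_lt_one.trans_le hc).ne'
  calc c * Φ (a / c) ≤ c * (c⁻¹ * Φ a) := by
        rw [div_eq_mul_inv, mul_comm a]; gcongr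
    _ = Φ a := by rw [← mul_assoc, ENNReal.mul_inv_cancel hc0 hc', one_mul]

/-- A pointwise substitute for Jensen's inequality. -/
theorem IsOrliczFn.le_add_mul_apply {Φ : ℝ≥0∞ → ℝ≥0∞} (hΦ : IsOrliczFn Φ) {a : ℝ≥0∞} (ha : a ≠ 0)
    (ha' : a ≠ ∞) (g : ℝ≥0∞) : g ≤ a + a / Φ a * Φ g := by
  rcases le_or_gt g a with h | h
  · exact h.trans le_self_add
  refine le_add_left ?_
  have h0 := hΦ.apply_ne_zero ha
  have h1 := hΦ.finite a ha'
  rcases eq_or_ne g ∞ with rfl | hg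
  · rw [hΦ.map_top, ENNReal.mul_top (ENNReal.div_pos ha h1).ne']
  have hg0 : g ≠ 0 := (pos_of_gt h).ne'
  have key := hΦ.mul_apply_div_le (c := g / a)
    ((ENNReal.le_div_iff_mul_le (.inl ha) (.inl ha')).2 (by simpa using h.le))
    (ENNReal.div_ne_top hg ha) g
  have e : g / (g / a) = a := by
    rw [ENNReal.div_div_cancel hg0 hg]
  rw [e] at key
  calc g = a / Φ a * (g / a * Φ a) := by
        rw [div_eq_mul_inv, div_eq_mul_inv,
          show a * (Φ a)⁻¹ * (g * a⁻¹ * Φ a) = (a * a⁻¹) * ((Φ a) * (Φ a)⁻¹) * g by ring,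
          ENNReal.mul_inv_cancel ha ha', ENNReal.mul_inv_cancel h0 h1, one_mul, one_mul]
    _ ≤ _ := by gcongr

theorem IsOrliczFn.lintegral_le {X : Type*} [MeasurableSpace X] {Φ : ℝ≥0∞ → ℝ≥0∞}
    (hΦ : IsOrliczFn Φ) {ν : Measure X} {a : ℝ≥0∞} (ha : a ≠ 0) (ha' : a ≠ ∞) (g : X → ℝ≥0∞) :
    ∫⁻ x, g x ∂ν ≤ a * ν univ + a / Φ a * ∫⁻ x, Φ (g x) ∂ν := by
  calc ∫⁻ x, g x ∂ν ≤ ∫⁻ x, (a + a / Φ a * Φ (g x)) ∂ν :=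
        lintegral_mono fun x => hΦ.le_add_mul_apply ha ha' _
    _ = _ := by
        rw [lintegral_add_left measurable_const, lintegral_const,
          lintegral_const_mul' _ _ (ENNReal.div_ne_top ha' (hΦ.apply_ne_zero ha))]

theorem IsOrliczFn.lintegral_le_two_mul_yInv {X : Type*} [MeasurableSpace X] {Φ : ℝ≥0∞ → ℝ≥0∞}
    (hΦ : IsOrliczFn Φ) {ν : Measure X} {g : X → ℝ≥0∞} {S T : ℝ≥0∞} (hS : S ≠ 0) (hS' : S ≠ ∞)
    (hT : T ≠ 0) (hT' : T ≠ ∞) (hν : ν univ ≤ S) (hg : ∫⁻ x, Φ (g x) ∂ν ≤ T) :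
    ∫⁻ x, g x ∂ν ≤ 2 * (S * yInv Φ (T / S)) := by
  have h0 : T / S ≠ 0 := (ENNReal.div_pos hT hS').ne'
  have h1 : T / S ≠ ∞ := ENNReal.div_ne_top hT' hS
  refine (hΦ.lintegral_le (hΦ.yInv_ne_zero h0) (hΦ.yInv_ne_top h1) g).trans ?_
  rw [hΦ.apply_yInv, two_mul, mul_comm S]
  refine add_le_add (by gcongr) ?_
  calc yInv Φ (T / S) / (T / S) * ∫⁻ x, Φ (g x) ∂ν ≤ yInv Φ (T / S) / (T / S) * T := by gcongr
    _ = yInv Φ (T / S) * S := by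
      rw [div_eq_mul_inv, ENNReal.inv_div (.inl hS') (.inl hS), mul_assoc,
        ENNReal.div_mul_cancel hT hT']

theorem lintegral_Ioi_rpow {θ w : ℝ} (hθ : θ < 1) (hw : 0 < w) :
    ∫⁻ s in Ioi w, ENNReal.ofReal (s ^ (θ - 2)) = ENNReal.ofReal (w ^ (θ - 1) / (1 - θ)) := by
  rw [← ofReal_integral_eq_lintegral_ofReal (integrableOn_Ioi_rpow_of_lt (by linarith) hw),
    integral_Ioi_rpow_of_lt (by linarith) hw]
  · rw [show θ - 2 + 1 = -(1 - θ) by ring, show θ - 1 = -(1 - θ) by ring, neg_div_neg_eq]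
  · filter_upwards [ae_restrict_mem measurableSet_Ioi] with s hs
    exact Real.rpow_nonneg (hw.trans hs).le _

theorem lintegral_Ioc_rpow {θ u : ℝ} (hθ : 0 < θ) (hu : 0 < u) :
    ∫⁻ s in Ioc 0 u, ENNReal.ofReal (s ^ (θ - 1)) = ENNReal.ofReal (u ^ θ / θ) := by
  rw [← ofReal_integral_eq_lintegral_ofReal, ← intervalIntegral.integral_of_le hu.le,
    integral_rpow (.inl (by linarith))]
  · simp [Real.zero_rpow hθ.ne']
  · exact (intervalIntegral.intervalIntegrable_rpow' (by linarith)).1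
  · filter_upwards [ae_restrict_mem measurableSet_Ioc] with s hs
    exact Real.rpow_nonneg hs.1.le _

/-- The volume of the unit ball. -/
def unitVol (n : ℕ) : ℝ := volume.real (ball (0 : Eu n) 1)

theorem unitVol_pos (n : ℕ) : 0 < unitVol n :=
  ENNReal.toReal_pos (measure_ball_pos _ _ one_pos).ne' measure_ball_lt_top.ne

theorem volume_ball_eq {n : ℕ} (x : Eu n) {r : ℝ} (hr : 0 < r) :
    volume (ball x r) = ENNReal.ofReal (unitVol n * r ^ n) := by
  rw [Measure.addHaar_ball_of_pos _ _ hr, finrank_euclideanSpace_fin, mul_comm,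
    ENNReal.ofReal_mul (unitVol_pos n).le, unitVol, ofReal_measureReal measure_ball_lt_top.ne]

theorem unitVol_mul_pow_lt_iff {n : ℕ} (hn : n ≠ 0) {s t : ℝ} (hs : 0 < s) (ht : 0 ≤ t) :
    unitVol n * t ^ n < s ↔ t < (s / unitVol n) ^ (1 / n : ℝ) := by
  have hb := unitVol_pos n
  rw [mul_comm, ← lt_div_iff₀ hb, one_div,
    Real.lt_rpow_inv_iff_of_pos ht (by positivity) (by positivity), Real.rpow_natCast]

theorem exists_ball_of_volume {n : ℕ} (hn : n ≠ 0) {s : ℝ} (hs : 0 < s) :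
    ∃ ρ : ℝ, 0 < ρ ∧ unitVol n * ρ ^ n = s ∧
      ∀ x : Eu n, {y | unitVol n * ‖x - y‖ ^ n < s} = ball x ρ := by
  have hb := unitVol_pos n
  refine ⟨(s / unitVol n) ^ (1 / n : ℝ), by positivity, ?_, fun x => ?_⟩
  · rw [one_div, Real.rpow_inv_natCast_pow (by positivity) hn]
    field_simp
  · ext y
    rw [mem_ofPred_eq, unitVol_mul_pow_lt_iff hn hs (norm_nonneg _), mem_ball, dist_comm,
      dist_eq_norm]

theorem volume_setOf_unitVol_mul_pow_lt {n : ℕ} (hn : n ≠ 0) {s : ℝ} (hs : 0 < s) (x : Eu n) :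
    volume {y | unitVol n * ‖x - y‖ ^ n < s} = ENNReal.ofReal s := by
  obtain ⟨ρ, hρ, h1, h2⟩ := exists_ball_of_volume hn hs
  rw [h2, volume_ball_eq _ hρ, h1]

theorem measurableSet_setOf_unitVol_mul_pow_lt {n : ℕ} (s : ℝ) (x : Eu n) :
    MeasurableSet {y | unitVol n * ‖x - y‖ ^ n < s} :=
  measurableSet_lt (by fun_prop) measurable_const

theorem measurable_setLIntegral_unitVol {n : ℕ} (ν : Measure (Eu n)) [SFinite ν] {g : Eu n → ℝ≥0∞}
    (hg : Measurable g) : Measurable fun p : Eu n × ℝ =>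
      ∫⁻ y in {y | unitVol n * ‖p.1 - y‖ ^ n < p.2}, g y ∂ν := by
  have hE : MeasurableSet {q : (Eu n × ℝ) × Eu n | unitVol n * ‖q.1.1 - q.2‖ ^ n < q.1.2} :=
    measurableSet_lt (by fun_prop) (by fun_prop)
  have h := ((hg.comp measurable_snd).indicator hE).lintegral_prod_right' (ν := ν)
  refine (congrArg Measurable (funext fun p => ?_)).mpr h
  rw [← lintegral_indicator (measurableSet_setOf_unitVol_mul_pow_lt _ _)]
  rfl

/-- The integral of `s ^ (θ - 2)` times the mass of `g` on the ball of volume `s` centred at `x`.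
For `I = (0, ∞)` this is, up to a constant, the Riesz potential of order `θ * n` of `g`. -/
def layerPotential {n : ℕ} (θ : ℝ) (ν : Measure (Eu n)) (I : Set ℝ) (g : Eu n → ℝ≥0∞) (x : Eu n) :
    ℝ≥0∞ :=
  ∫⁻ s in I, ENNReal.ofReal (s ^ (θ - 2)) *
    ∫⁻ y in {y | unitVol n * ‖x - y‖ ^ n < s}, g y ∂ν

theorem layerPotential_union_le {n : ℕ} (θ : ℝ) (ν : Measure (Eu n)) (I J : Set ℝ)
    (g : Eu n → ℝ≥0∞) (x : Eu n) : layerPotential θ ν (I ∪ J) g x ≤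
      layerPotential θ ν I g x + layerPotential θ ν J g x :=
  lintegral_union_le _ _ _

theorem measurable_layerPotential {n : ℕ} (θ : ℝ) (ν : Measure (Eu n)) [SFinite ν] (I : Set ℝ)
    {g : Eu n → ℝ≥0∞} (hg : Measurable g) : Measurable (layerPotential θ ν I g) := by
  have h : Measurable fun p : Eu n × ℝ => ENNReal.ofReal (p.2 ^ (θ - 2)) *
      ∫⁻ y in {y | unitVol n * ‖p.1 - y‖ ^ n < p.2}, g y ∂ν :=
    (by fun_prop : Measurable fun p : Eu n × ℝ => ENNReal.ofReal (p.2 ^ (θ - 2))).mul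
      (measurable_setLIntegral_unitVol ν hg)
  exact h.lintegral_prod_right'

theorem layerPotential_Ioi_eq {n : ℕ} (θ : ℝ) (ν : Measure (Eu n)) [SFinite ν]
    {g : Eu n → ℝ≥0∞} (hg : Measurable g) (x : Eu n) :
    layerPotential θ ν (Ioi 0) g x =
      ∫⁻ y, g y * (∫⁻ s in Ioi (unitVol n * ‖x - y‖ ^ n), ENNReal.ofReal (s ^ (θ - 2))) ∂ν := by
  have hE : MeasurableSet {q : ℝ × Eu n | unitVol n * ‖x - q.2‖ ^ n < q.1} :=
    measurableSet_lt (by fun_prop) (by fun_prop)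
  have hm : Measurable fun q : ℝ × Eu n => ENNReal.ofReal (q.1 ^ (θ - 2)) * g q.2 := by fun_prop
  have h1 : layerPotential θ ν (Ioi 0) g x = ∫⁻ s in Ioi (0 : ℝ), ∫⁻ y,
      {q : ℝ × Eu n | unitVol n * ‖x - q.2‖ ^ n < q.1}.indicator
        (fun q => ENNReal.ofReal (q.1 ^ (θ - 2)) * g q.2) (s, y) ∂ν := by
    refine lintegral_congr fun s => ?_
    rw [← lintegral_const_mul' _ _ ENNReal.ofReal_ne_top,
      ← lintegral_indicator (measurableSet_setOf_unitVol_mul_pow_lt _ _)]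
    rfl
  rw [h1, lintegral_lintegral_swap (f := fun s y =>
      {q : ℝ × Eu n | unitVol n * ‖x - q.2‖ ^ n < q.1}.indicator
        (fun q => ENNReal.ofReal (q.1 ^ (θ - 2)) * g q.2) (s, y)) (hm.indicator hE).aemeasurable]
  refine lintegral_congr fun y => ?_
  have hw : 0 ≤ unitVol n * ‖x - y‖ ^ n := mul_nonneg (unitVol_pos n).le (by positivity)
  have h2 : (fun s : ℝ => {q : ℝ × Eu n | unitVol n * ‖x - q.2‖ ^ n < q.1}.indicator
        (fun q => ENNReal.ofReal (q.1 ^ (θ - 2)) * g q.2) (s, y)) =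
      (Ioi (unitVol n * ‖x - y‖ ^ n)).indicator
        fun s => ENNReal.ofReal (s ^ (θ - 2)) * g y := rfl
  rw [h2, lintegral_indicator measurableSet_Ioi, Measure.restrict_restrict measurableSet_Ioi,
    inter_eq_left.2 (Ioi_subset_Ioi hw), lintegral_mul_const _ (by fun_prop), mul_comm]

theorem lintegral_layerPotential {n : ℕ} (hn : n ≠ 0) (θ : ℝ) (ν : Measure (Eu n)) [SFinite ν]
    {I : Set ℝ} (hI : MeasurableSet I) (hI0 : I ⊆ Ioi 0) {g : Eu n → ℝ≥0∞} (hg : Measurable g) :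
    ∫⁻ x, layerPotential θ ν I g x =
      (∫⁻ s in I, ENNReal.ofReal (s ^ (θ - 1))) * ∫⁻ y, g y ∂ν := by
  have h : Measurable fun p : Eu n × ℝ => ENNReal.ofReal (p.2 ^ (θ - 2)) *
      ∫⁻ y in {y | unitVol n * ‖p.1 - y‖ ^ n < p.2}, g y ∂ν :=
    (by fun_prop : Measurable fun p : Eu n × ℝ => ENNReal.ofReal (p.2 ^ (θ - 2))).mul
      (measurable_setLIntegral_unitVol ν hg)
  unfold layerPotential
  rw [lintegral_lintegral_swap h.aemeasurable, ← lintegral_mul_const _ (by fun_prop)]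
  refine setLIntegral_congr_fun hI fun s hs => ?_
  have hs0 : 0 < s := hI0 hs
  have hE : MeasurableSet {q : Eu n × Eu n | unitVol n * ‖q.1 - q.2‖ ^ n < s} :=
    measurableSet_lt (by fun_prop) (by fun_prop)
  have h1 : ∫⁻ x, ∫⁻ y in {y | unitVol n * ‖x - y‖ ^ n < s}, g y ∂ν =
      ∫⁻ x, ∫⁻ y, {q : Eu n × Eu n | unitVol n * ‖q.1 - q.2‖ ^ n < s}.indicator
        (fun q => g q.2) (x, y) ∂ν := by
    refine lintegral_congr fun x => ?_
    rw [← lintegral_indicator (measurableSet_setOf_unitVol_mul_pow_lt _ _)]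
    rfl
  have h2 : ∀ y, ∫⁻ x, {q : Eu n × Eu n | unitVol n * ‖q.1 - q.2‖ ^ n < s}.indicator
        (fun q => g q.2) (x, y) = ENNReal.ofReal s * g y := fun y => by
    have e : (fun x : Eu n => {q : Eu n × Eu n | unitVol n * ‖q.1 - q.2‖ ^ n < s}.indicator
        (fun q => g q.2) (x, y)) =
        {x | unitVol n * ‖y - x‖ ^ n < s}.indicator fun _ => g y := by
      ext x
      simp only [indicator, mem_ofPred_eq, norm_sub_rev x y]
    rw [e, lintegral_indicator_const (measurableSet_setOf_unitVol_mul_pow_lt _ _),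
      volume_setOf_unitVol_mul_pow_lt hn hs0, mul_comm]
  change ∫⁻ x, ENNReal.ofReal (s ^ (θ - 2)) * _ = _
  rw [lintegral_const_mul' _ _ ENNReal.ofReal_ne_top, h1,
    lintegral_lintegral_swap (f := fun x y =>
      {q : Eu n × Eu n | unitVol n * ‖q.1 - q.2‖ ^ n < s}.indicator (fun q => g q.2) (x, y))
      ((hg.comp measurable_snd).indicator hE).aemeasurable,
    lintegral_congr h2, lintegral_const_mul' _ _ ENNReal.ofReal_ne_top, ← mul_assoc,
    ← ENNReal.ofReal_mul (by positivity), ← Real.rpow_add_one hs0.ne']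
  ring_nf

theorem enorm_riesz_le {n : ℕ} (hn : n ≠ 0) {α : ℝ} (hαn : α < n) {f : Eu n → ℝ}
    {g : Eu n → ℝ≥0∞} (hg : Measurable g) (hfg : ∀ᵐ y, ‖f y‖ₑ = g y) (x : Eu n) :
    ‖riesz α f x‖ₑ ≤ ENNReal.ofReal ((1 - α / n) * unitVol n ^ (1 - α / n)) *
      layerPotential (α / n) volume (Ioi 0) g x := by
  have hn0 : (0 : ℝ) < n := by positivity
  have hθ : α / n < 1 := (div_lt_one hn0).2 hαn
  have hb := unitVol_pos n
  rw [layerPotential_Ioi_eq _ _ hg, ← lintegral_const_mul' _ _ ENNReal.ofReal_ne_top]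
  refine (enorm_integral_le_lintegral_enorm _).trans (lintegral_mono_ae ?_)
  filter_upwards [hfg] with y hy
  rw [← hy]
  rcases eq_or_ne x y with rfl | hxy
  · simp [Real.zero_rpow (sub_pos.2 hαn).ne']
  have ht : 0 < ‖x - y‖ := norm_pos_iff.2 (sub_ne_zero.2 hxy)
  rw [lintegral_Ioi_rpow hθ (by positivity), ← ofReal_norm, ← ofReal_norm,
    ← ENNReal.ofReal_mul (norm_nonneg _), ← ENNReal.ofReal_mul
      (mul_nonneg (by linarith) (by positivity))]
  refine ENNReal.ofReal_le_ofReal (le_of_eq ?_)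
  have e : (unitVol n * ‖x - y‖ ^ n) ^ (α / n - 1) =
      (unitVol n ^ (1 - α / n))⁻¹ * (‖x - y‖ ^ (n - α))⁻¹ := by
    rw [Real.mul_rpow hb.le (by positivity), ← Real.rpow_natCast, ← Real.rpow_mul ht.le,
      ← Real.rpow_neg hb.le, ← Real.rpow_neg ht.le]
    congr 2
    · ring
    · field_simp; ring
  have h1 : n - α ≠ 0 := (sub_pos.2 hαn).ne'
  have h2 : 0 < unitVol n ^ (1 - α / n) := by positivity
  rw [e, norm_div, Real.norm_of_nonneg (Real.rpow_nonneg ht.le _)]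
  field_simp

theorem layerPotential_le_of_forall_le {n : ℕ} {θ : ℝ} {ν : Measure (Eu n)} {I : Set ℝ}
    (hI : MeasurableSet I) (hI0 : I ⊆ Ioi 0) {g : Eu n → ℝ≥0∞} {x : Eu n} {D : ℝ≥0∞} (hD : D ≠ ∞)
    {Y : ℝ → ℝ≥0∞} (h : ∀ s ∈ I, ∫⁻ y in {y | unitVol n * ‖x - y‖ ^ n < s}, g y ∂ν ≤
      D * (ENNReal.ofReal s * Y s)) :
    layerPotential θ ν I g x ≤
      D * ∫⁻ s in I, ENNReal.ofReal (s ^ θ) * Y s / ENNReal.ofReal s := by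
  rw [← lintegral_const_mul' _ _ hD]
  refine setLIntegral_mono' hI fun s hs => ?_
  have hs0 : 0 < s := hI0 hs
  calc _ ≤ ENNReal.ofReal (s ^ (θ - 2)) * (D * (ENNReal.ofReal s * Y s)) := by
        gcongr; exact h s hs
    _ = D * (ENNReal.ofReal (s ^ (θ - 2) * s) * Y s) := by
        rw [ENNReal.ofReal_mul (by positivity)]; ring
    _ = D * (ENNReal.ofReal (s ^ θ / s) * Y s) := by
        rw [← Real.rpow_add_one hs0.ne', ← Real.rpow_sub_one hs0.ne']
        ring_nf
    _ = _ := by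
        rw [ENNReal.ofReal_div_of_pos hs0, div_eq_mul_inv, div_eq_mul_inv]; ring

theorem layerPotential_Ioi_le_far {n : ℕ} (hn : n ≠ 0) {θ lam : ℝ} (hlam : lam ≤ 1)
    {Φ : ℝ≥0∞ → ℝ≥0∞} (hΦ : IsOrliczFn Φ) {g : Eu n → ℝ≥0∞}
    (hg : ∀ t : ℝ, 0 < t → ∫⁻ y in ball (0 : Eu n) t, Φ (g y) ≤
      ENNReal.ofReal ((unitVol n * t ^ n) ^ lam))
    {r : ℝ} (hr : 0 < r) {x : Eu n} (hx : x ∈ ball (0 : Eu n) r) :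
    layerPotential θ volume (Ioi (unitVol n * r ^ n)) g x ≤ ENNReal.ofReal (2 ^ (n + 1)) *
      ∫⁻ s in Ioi (unitVol n * r ^ n), ENNReal.ofReal (s ^ θ) *
        yInv Φ (ENNReal.ofReal (s ^ (lam - 1))) / ENNReal.ofReal s := by
  have hb := unitVol_pos n
  have hU : 0 < unitVol n * r ^ n := by positivity
  refine layerPotential_le_of_forall_le measurableSet_Ioi (Ioi_subset_Ioi hU.le)
    ENNReal.ofReal_ne_top fun s hs => ?_
  have hs0 : 0 < s := hU.trans hs
  obtain ⟨ρ, hρ, h1, h2⟩ := exists_ball_of_volume hn hs0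
  have hrρ : r < ρ := by
    refine lt_of_pow_lt_pow_left₀ n hρ.le ?_
    have : unitVol n * r ^ n < unitVol n * ρ ^ n := h1 ▸ hs
    exact lt_of_mul_lt_mul_left this hb.le
  have hS : unitVol n * (2 * ρ) ^ n = 2 ^ n * s := by rw [← h1, mul_pow]; ring
  have hS0 : 0 < 2 ^ n * s := by positivity
  have hT0 : 0 < (2 ^ n * s) ^ lam := by positivity
  have hsub : ball x ρ ⊆ ball 0 (2 * ρ) := ball_subset_ball' (by
    rw [mem_ball] at hx; linarith)
  rw [h2]
  refine (lintegral_mono_set hsub).trans ?_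
  have key := hΦ.lintegral_le_two_mul_yInv (ν := volume.restrict (ball (0 : Eu n) (2 * ρ))) (g := g)
    (S := ENNReal.ofReal (2 ^ n * s)) (T := ENNReal.ofReal ((2 ^ n * s) ^ lam))
    (by simpa using hS0) ENNReal.ofReal_ne_top (by simpa using hT0) ENNReal.ofReal_ne_top
    (by rw [Measure.restrict_apply_univ, volume_ball_eq _ (by positivity), hS])
    (by rw [← hS]; exact hg _ (by positivity))
  refine key.trans ?_
  have hY : yInv Φ (ENNReal.ofReal ((2 ^ n * s) ^ lam) / ENNReal.ofReal (2 ^ n * s)) ≤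
      yInv Φ (ENNReal.ofReal (s ^ (lam - 1))) := by
    refine yInv_mono Φ ?_
    rw [← ENNReal.ofReal_div_of_pos hS0, ← Real.rpow_sub_one hS0.ne']
    refine ENNReal.ofReal_le_ofReal (Real.rpow_le_rpow_of_nonpos hs0 ?_ (by linarith))
    exact le_mul_of_one_le_left hs0.le (one_le_pow₀ one_le_two)
  calc _ ≤ 2 * (ENNReal.ofReal (2 ^ n * s) * yInv Φ (ENNReal.ofReal (s ^ (lam - 1)))) := by gcongr
    _ = _ := by
      rw [ENNReal.ofReal_mul (by positivity), pow_succ, ENNReal.ofReal_mul (by positivity)]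
      simp only [ENNReal.ofReal_ofNat]
      ring

theorem layerPotential_Ioc_le_restrict {n : ℕ} (hn : n ≠ 0) (θ : ℝ) (g : Eu n → ℝ≥0∞)
    {r : ℝ} (hr : 0 < r) {x : Eu n} (hx : x ∈ ball (0 : Eu n) r) :
    layerPotential θ volume (Ioc 0 (unitVol n * r ^ n)) g x ≤
      layerPotential θ (volume.restrict (ball 0 (2 * r))) (Ioi 0) g x := by
  have hb := unitVol_pos n
  refine le_trans (setLIntegral_mono' measurableSet_Ioc fun s hs => ?_)
    (lintegral_mono_set Ioc_subset_Ioi_self)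
  obtain ⟨ρ, hρ, h1, h2⟩ := exists_ball_of_volume hn hs.1
  have hρr : ρ ≤ r := by
    refine le_of_pow_le_pow_left₀ hn hr.le ?_
    have : unitVol n * ρ ^ n ≤ unitVol n * r ^ n := h1 ▸ hs.2
    exact le_of_mul_le_mul_left this hb
  have hsub : ball x ρ ⊆ ball 0 (2 * r) := ball_subset_ball' (by
    rw [mem_ball] at hx; linarith)
  rw [h2, Measure.restrict_restrict measurableSet_ball, inter_eq_left.2 hsub]

theorem layerPotential_restrict_Ioi_le {n : ℕ} (hn : n ≠ 0) {θ : ℝ}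
    {Φ : ℝ≥0∞ → ℝ≥0∞} (hΦ : IsOrliczFn Φ) {g : Eu n → ℝ≥0∞} {B : Set (Eu n)} {T : ℝ} (hT : 0 < T)
    (hg : ∫⁻ y in B, Φ (g y) ≤ ENNReal.ofReal T) {u : ℝ} (hu : 0 < u) (x : Eu n) :
    layerPotential θ (volume.restrict B) (Ioi u) g x ≤ 2 *
      ∫⁻ s in Ioi u, ENNReal.ofReal (s ^ θ) *
        yInv Φ (ENNReal.ofReal (T / s)) / ENNReal.ofReal s := by
  refine layerPotential_le_of_forall_le measurableSet_Ioi (Ioi_subset_Ioi hu.le)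
    (by simp) fun s hs => ?_
  have hs0 : 0 < s := hu.trans hs
  rw [ENNReal.ofReal_div_of_pos hs0]
  refine hΦ.lintegral_le_two_mul_yInv (by simpa using hs0) ENNReal.ofReal_ne_top (by simpa using hT)
    ENNReal.ofReal_ne_top ?_ ((lintegral_mono' Measure.restrict_le_self le_rfl).trans hg)
  rw [Measure.restrict_apply_univ]
  exact (Measure.restrict_le_self _).trans_eq (volume_setOf_unitVol_mul_pow_lt hn hs0 x)

theorem layerPotential_Ioc_le {n : ℕ} (hn : n ≠ 0) {θ : ℝ} (hθ : 0 < θ) {Φ : ℝ≥0∞ → ℝ≥0∞}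
    (hΦ : IsOrliczFn Φ) {ν : Measure (Eu n)} (hν : ν ≤ volume) {a : ℝ≥0∞} (ha : a ≠ 0) (ha' : a ≠ ∞)
    (g : Eu n → ℝ≥0∞) {u : ℝ} (hu : 0 < u) (x : Eu n) :
    layerPotential θ ν (Ioc 0 u) g x ≤
      a * ENNReal.ofReal (u ^ θ / θ) + a / Φ a * layerPotential θ ν (Ioc 0 u) (Φ ∘ g) x := by
  rw [← lintegral_Ioc_rpow hθ hu, ← lintegral_const_mul' _ _ ha', layerPotential, layerPotential,
    ← lintegral_const_mul' _ _ (ENNReal.div_ne_top ha' (hΦ.apply_ne_zero ha)),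
    ← lintegral_add_left (by fun_prop)]
  refine setLIntegral_mono' measurableSet_Ioc fun s hs => ?_
  have hs0 : 0 < s := hs.1
  refine (mul_le_mul_right (hΦ.lintegral_le ha ha' g) _).trans ?_
  rw [mul_add, mul_left_comm _ (a / Φ a)]
  refine add_le_add ?_ le_rfl
  have h1 : ν.restrict {y | unitVol n * ‖x - y‖ ^ n < s} univ ≤ ENNReal.ofReal s := by
    rw [Measure.restrict_apply_univ]
    exact (hν _).trans_eq (volume_setOf_unitVol_mul_pow_lt hn hs0 x)
  calc _ ≤ ENNReal.ofReal (s ^ (θ - 2)) * (a * ENNReal.ofReal s) := by gcongr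
    _ = a * ENNReal.ofReal (s ^ (θ - 2) * s) := by
        rw [ENNReal.ofReal_mul (by positivity)]; ring
    _ = _ := by
        rw [← Real.rpow_add_one hs0.ne']
        ring_nf

theorem ofReal_rpow_mul_yInv_le {θ : ℝ} (hθ : 0 ≤ θ) (Φ : ℝ≥0∞ → ℝ≥0∞) {T u : ℝ} (hT : 0 ≤ T)
    (hu : 0 < u) :
    ENNReal.ofReal (u ^ θ) * yInv Φ (ENNReal.ofReal (T / (2 * u))) ≤
      2 * ∫⁻ s in Ioi u, ENNReal.ofReal (s ^ θ) *
        yInv Φ (ENNReal.ofReal (T / s)) / ENNReal.ofReal s := by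
  have h1 : ∫⁻ _ in Ioc u (2 * u), ENNReal.ofReal (u ^ θ) *
      yInv Φ (ENNReal.ofReal (T / (2 * u))) / ENNReal.ofReal (2 * u) ≤
      ∫⁻ s in Ioi u, ENNReal.ofReal (s ^ θ) *
        yInv Φ (ENNReal.ofReal (T / s)) / ENNReal.ofReal s := by
    refine le_trans (setLIntegral_mono' measurableSet_Ioc fun s hs => ?_)
      (lintegral_mono_set Ioc_subset_Ioi_self)
    have hs0 : 0 < s := hu.trans hs.1
    have e1 : u ^ θ ≤ s ^ θ := Real.rpow_le_rpow hu.le hs.1.le hθ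
    have e2 : T / (2 * u) ≤ T / s := div_le_div_of_nonneg_left hT hs0 hs.2
    have e3 := yInv_mono Φ (ENNReal.ofReal_le_ofReal e2)
    exact ENNReal.div_le_div (mul_le_mul' (ENNReal.ofReal_le_ofReal e1) e3)
      (ENNReal.ofReal_le_ofReal hs.2)
  refine le_trans (le_of_eq ?_) (mul_le_mul_right h1 2)
  have hu2 : 0 < 2 * u := by positivity
  rw [setLIntegral_const, Real.volume_Ioc, mul_left_comm, show 2 * u - u = u by ring,
    ← ENNReal.ofReal_ofNat 2, ← ENNReal.ofReal_mul zero_le_two,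
    ENNReal.div_mul_cancel (by simpa using hu) ENNReal.ofReal_ne_top]

theorem layerPotential_weak_estimate_near {n : ℕ} (hn : n ≠ 0) {θ : ℝ} (hθ : 0 < θ) (hθ1 : θ < 1)
    {Φ : ℝ≥0∞ → ℝ≥0∞} (hΦ : IsOrliczFn Φ) {g : Eu n → ℝ≥0∞} (hgm : Measurable g) {B : Set (Eu n)}
    {T : ℝ} (hT : 0 < T) (hg : ∫⁻ y in B, Φ (g y) ≤ ENNReal.ofReal T) {u τ : ℝ} (hu : 0 < u)
    (hτ : 0 < τ)
    (h : ∫⁻ s in Ioi u, ENNReal.ofReal (s ^ θ) * yInv Φ (ENNReal.ofReal (T / s)) /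
      ENNReal.ofReal s ≤ ENNReal.ofReal (θ * τ)) :
    volume {x | ENNReal.ofReal (6 * τ) < layerPotential θ (volume.restrict B) (Ioi 0) g x} ≤
      ENNReal.ofReal (2 * u) := by
  set ν := (volume : Measure (Eu n)).restrict B
  set v : ℝ := T / (2 * u) with hv
  have hv0 : 0 < v := by positivity
  set a := yInv Φ (ENNReal.ofReal v) with ha
  have ha0 : a ≠ 0 := hΦ.yInv_ne_zero (by simpa using hv0)
  have hat : a ≠ ∞ := hΦ.yInv_ne_top ENNReal.ofReal_ne_top
  have hΦa : Φ a = ENNReal.ofReal v := hΦ.apply_yInv _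
  have hq0 : 0 < u ^ θ / θ := by positivity
  set q := ENNReal.ofReal (u ^ θ / θ) with hq
  have haq : a * q ≤ ENNReal.ofReal (2 * τ) := by
    have h1 := (ofReal_rpow_mul_yInv_le hθ.le Φ hT.le hu).trans (mul_le_mul_right h 2)
    calc a * q = (ENNReal.ofReal (u ^ θ) * a) / ENNReal.ofReal θ := by
          rw [hq, ENNReal.ofReal_div_of_pos hθ, mul_comm, div_eq_mul_inv, div_eq_mul_inv]; ring
      _ ≤ 2 * ENNReal.ofReal (θ * τ) / ENNReal.ofReal θ := by gcongr
      _ = ENNReal.ofReal (2 * τ) := by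
          rw [← ENNReal.ofReal_ofNat 2, ← ENNReal.ofReal_mul zero_le_two,
            ← ENNReal.ofReal_div_of_pos hθ]
          congr 1; field_simp
  have hmid (x : Eu n) : layerPotential θ ν (Ioi u) g x ≤ ENNReal.ofReal (2 * τ) := by
    refine (layerPotential_restrict_Ioi_le hn hΦ hT hg hu x).trans
      ((mul_le_mul_right h 2).trans ?_)
    rw [← ENNReal.ofReal_ofNat 2, ← ENNReal.ofReal_mul zero_le_two]
    refine ENNReal.ofReal_le_ofReal ?_
    nlinarith
  have hsub : {x | ENNReal.ofReal (6 * τ) < layerPotential θ ν (Ioi 0) g x} ⊆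
      {x | q * Φ a ≤ layerPotential θ ν (Ioc 0 u) (Φ ∘ g) x} := fun x hx => by
    rw [mem_ofPred_eq] at hx ⊢
    by_contra! hlt
    refine hx.not_ge ?_
    rw [← Ioc_union_Ioi_eq_Ioi hu.le]
    refine (layerPotential_union_le _ _ _ _ _ _).trans ?_
    refine (add_le_add (layerPotential_Ioc_le hn hθ hΦ Measure.restrict_le_self ha0 hat g hu x)
      (hmid x)).trans ?_
    have h2 : a / Φ a * layerPotential θ ν (Ioc 0 u) (Φ ∘ g) x ≤ a * q := by
      calc _ ≤ a / Φ a * (q * Φ a) := by gcongr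
        _ = a / Φ a * Φ a * q := by ring
        _ = a * q := by
          rw [ENNReal.div_mul_cancel (hΦ.apply_ne_zero ha0) (hΦ.finite a hat)]
    calc _ ≤ ENNReal.ofReal (2 * τ) + ENNReal.ofReal (2 * τ) + ENNReal.ofReal (2 * τ) := by
          gcongr
          exact h2.trans haq
      _ = _ := by
        rw [← ENNReal.ofReal_add (by positivity) (by positivity),
          ← ENNReal.ofReal_add (by positivity) (by positivity)]
        ring_nf
  refine (measure_mono hsub).trans ?_
  have hΦm : Measurable (Φ ∘ g) := hΦ.continuous.measurable.comp hgm
  have h3 := mul_meas_ge_le_lintegral (μ := volume)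
    (measurable_layerPotential θ ν (Ioc 0 u) hΦm) (q * Φ a)
  rw [lintegral_layerPotential hn θ ν measurableSet_Ioc Ioc_subset_Ioi_self hΦm,
    lintegral_Ioc_rpow hθ hu] at h3
  have h4 : q * Φ a * ENNReal.ofReal (2 * u) = q * ENNReal.ofReal T := by
    rw [hΦa, mul_assoc, ← ENNReal.ofReal_mul hv0.le, hv]
    congr 2; field_simp
  have h5 : q * Φ a ≠ 0 := mul_ne_zero (by simpa [hq] using hq0) (hΦ.apply_ne_zero ha0)
  have h6 : q * Φ a ≠ ∞ := ENNReal.mul_ne_top ENNReal.ofReal_ne_top (hΦ.finite a hat)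
  refine (ENNReal.mul_le_mul_iff_right h5 h6).1 (h3.trans ?_)
  rw [h4]
  gcongr
  exact hg

theorem layerPotential_weak_estimate {n : ℕ} (hn : n ≠ 0) {θ : ℝ} (hθ : 0 < θ) (hθ1 : θ < 1)
    {Φ Ψ : ℝ≥0∞ → ℝ≥0∞} (hΦ : IsOrliczFn Φ) (hΨ : IsOrliczFn Ψ) {lam mu : ℝ}
    (hlam : lam ≤ 1) (hmu : mu ≤ 1) {C₄ C₅ : ℝ} (hC₄ : 1 ≤ C₄) (hC₅ : 1 ≤ C₅)
    (h4 : ∀ u : ℝ, 0 < u →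
      (∫⁻ s in Ioi u,
        ENNReal.ofReal (s ^ θ) * yInv Φ (ENNReal.ofReal (s ^ (lam - 1))) /
          ENNReal.ofReal s) ≤ ENNReal.ofReal C₄ * yInv Ψ (ENNReal.ofReal (u ^ (mu - 1))))
    (h5 : ∀ u : ℝ, 0 < u → ∀ r : ℝ, 0 < r →
      (∫⁻ s in Ioi u,
        ENNReal.ofReal (s ^ θ) * yInv Φ (ENNReal.ofReal (r ^ lam / s)) /
          ENNReal.ofReal s) ≤ ENNReal.ofReal C₅ * yInv Ψ (ENNReal.ofReal (r ^ mu / u)))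
    {g : Eu n → ℝ≥0∞} (hgm : Measurable g)
    (hg : ∀ t : ℝ, 0 < t → ∫⁻ y in ball (0 : Eu n) t, Φ (g y) ≤
      ENNReal.ofReal ((unitVol n * t ^ n) ^ lam))
    {r σ : ℝ} (hr : 0 < r) (hσ : 0 < σ) :
    Ψ (ENNReal.ofReal (σ / (2 ^ (n + 1) * (12 * C₄ * C₅ / θ)))) *
      volume {x ∈ ball (0 : Eu n) r |
        ENNReal.ofReal σ < layerPotential θ volume (Ioi 0) g x} ≤
      ENNReal.ofReal ((unitVol n * r ^ n) ^ mu) := by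
  have hb := unitVol_pos n
  set U : ℝ := unitVol n * r ^ n with hU
  set R : ℝ := unitVol n * (2 * r) ^ n with hR
  have hU0 : 0 < U := by positivity
  have hR0 : 0 < R := by positivity
  have hRU : R = 2 ^ n * U := by rw [hR, hU, mul_pow]; ring
  set K : ℝ := 12 * C₄ * C₅ / θ with hK
  have hKθ : K * θ = 12 * C₄ * C₅ := by rw [hK]; field_simp
  have hK0 : 0 < K := by positivity
  have hC : 1 ≤ C₄ * C₅ := one_le_mul_of_one_le_of_one_le hC₄ hC₅
  have hC45 : C₄ ≤ C₄ * C₅ := le_mul_of_one_le_right (by linarith) hC₅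
  have hC54 : C₅ ≤ C₄ * C₅ := le_mul_of_one_le_left (by linarith) hC₄
  have hKC : 12 * (C₄ * C₅) ≤ K := by nlinarith
  set F : ℝ≥0∞ := ENNReal.ofReal (2 ^ (n + 1) * C₄) * yInv Ψ (ENNReal.ofReal (U ^ (mu - 1)))
    with hF
  have hfar : ∀ x ∈ ball (0 : Eu n) r, layerPotential θ volume (Ioi U) g x ≤ F := fun x hx => by
    refine (layerPotential_Ioi_le_far hn hlam hΦ hg hr hx).trans ?_
    rw [hF, ENNReal.ofReal_mul (by positivity), mul_assoc]
    gcongr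
    exact h4 U hU0
  rcases lt_or_ge (ENNReal.ofReal (σ / 2)) F with hA | hB
  · have h1 : ENNReal.ofReal (σ / (2 ^ (n + 1) * K)) ≤ yInv Ψ (ENNReal.ofReal (U ^ (mu - 1))) := by
      have hc : 0 < 2 ^ (n + 1) * C₄ := by positivity
      have h2 := ENNReal.div_le_of_le_mul' hA.le
      rw [← ENNReal.ofReal_div_of_pos hc] at h2
      refine (ENNReal.ofReal_le_ofReal ?_).trans h2
      rw [div_div]
      refine div_le_div_of_nonneg_left hσ.le (by positivity) ?_
      have : 2 * C₄ ≤ K := by linarith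
      calc 2 * (2 ^ (n + 1) * C₄) = 2 ^ (n + 1) * (2 * C₄) := by ring
        _ ≤ _ := by gcongr
    have h3 := hΨ.strictMono.monotone h1
    rw [hΨ.apply_yInv] at h3
    calc _ ≤ ENNReal.ofReal (U ^ (mu - 1)) * volume (ball (0 : Eu n) r) := by
          gcongr
          exact sep_subset _ _
      _ = _ := by
          rw [volume_ball_eq _ hr, ← hU, ← ENNReal.ofReal_mul (by positivity),
            ← Real.rpow_add_one hU0.ne', sub_add_cancel]
  · have hσK : 0 < σ / K := by positivity
    have hψ0 : Ψ (ENNReal.ofReal (σ / K)) ≠ 0 := hΨ.apply_ne_zero (by simpa using hσK)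
    have hψt : Ψ (ENNReal.ofReal (σ / K)) ≠ ∞ := hΨ.finite _ ENNReal.ofReal_ne_top
    set p : ℝ := (Ψ (ENNReal.ofReal (σ / K))).toReal with hp
    have hp0 : 0 < p := ENNReal.toReal_pos hψ0 hψt
    have hpe : ENNReal.ofReal p = Ψ (ENNReal.ofReal (σ / K)) := ENNReal.ofReal_toReal hψt
    set u : ℝ := R ^ mu / p with hu
    have hu0 : 0 < u := by positivity
    have hup : R ^ mu / u = p := by rw [hu]; field_simp
    have h6 : ∫⁻ s in Ioi u, ENNReal.ofReal (s ^ θ) * yInv Φ (ENNReal.ofReal (R ^ lam / s)) /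
        ENNReal.ofReal s ≤ ENNReal.ofReal (θ * (σ / 12)) := by
      refine (h5 u hu0 R hR0).trans ?_
      rw [hup, hpe, hΨ.yInv_apply, ← ENNReal.ofReal_mul (by linarith)]
      refine ENNReal.ofReal_le_ofReal ?_
      rw [mul_div_assoc', div_le_iff₀ hK0]
      nlinarith
    have h7 := layerPotential_weak_estimate_near hn hθ hθ1 hΦ hgm (Real.rpow_pos_of_pos hR0 lam)
      (hg (2 * r) (by positivity)) hu0 (by positivity) h6
    have hsub : {x ∈ ball (0 : Eu n) r |
        ENNReal.ofReal σ < layerPotential θ volume (Ioi 0) g x} ⊆ {x | ENNReal.ofReal (6 * (σ / 12))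
          < layerPotential θ (volume.restrict (ball 0 (2 * r))) (Ioi 0) g x} := by
      rintro x ⟨hxr, hx⟩
      rw [mem_ofPred_eq]
      by_contra! hle
      refine hx.not_ge ?_
      rw [← Ioc_union_Ioi_eq_Ioi hU0.le]
      refine (layerPotential_union_le _ _ _ _ _ _).trans ?_
      refine (add_le_add ((layerPotential_Ioc_le_restrict hn θ g hr hxr).trans hle)
        ((hfar x hxr).trans hB)).trans_eq ?_
      rw [← ENNReal.ofReal_add (by positivity) (by positivity)]
      ring_nf
    have h8 : Ψ (ENNReal.ofReal (σ / (2 ^ (n + 1) * K))) ≤ ENNReal.ofReal (p / 2 ^ (n + 1)) := by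
      have hk : (0 : ℝ) < 2 ^ (n + 1) := by positivity
      rw [mul_comm, ← div_div, ENNReal.ofReal_div_of_pos hk, ENNReal.ofReal_div_of_pos hk, hpe,
        ENNReal.le_div_iff_mul_le (.inl (by simp)) (.inl ENNReal.ofReal_ne_top), mul_comm]
      exact hΨ.mul_apply_div_le (ENNReal.one_le_ofReal.2 (one_le_pow₀ one_le_two))
        ENNReal.ofReal_ne_top _
    calc _ ≤ ENNReal.ofReal (p / 2 ^ (n + 1)) * ENNReal.ofReal (2 * u) :=
          mul_le_mul' h8 ((measure_mono hsub).trans h7)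
      _ = ENNReal.ofReal (R ^ mu / 2 ^ n) := by
          rw [← ENNReal.ofReal_mul (by positivity), hu, pow_succ]
          congr 1; field_simp
      _ ≤ _ := by
          refine ENNReal.ofReal_le_ofReal ?_
          rw [div_le_iff₀ (by positivity), hRU, Real.mul_rpow (by positivity) hU0.le, mul_comm]
          gcongr
          exact (Real.rpow_le_rpow_of_exponent_le (one_le_pow₀ one_le_two) hmu).trans_eq
            (Real.rpow_one _)

theorem lintegral_ball_le_of_centralNorm_lt {n : ℕ} {Φ : ℝ≥0∞ → ℝ≥0∞} (hΦ : IsOrliczFn Φ)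
    {lam : ℝ} {f : Eu n → ℝ} {N : ℝ≥0∞} (hN : centralNorm Φ lam f < N) {t : ℝ} (ht : 0 < t) :
    ∫⁻ y in ball (0 : Eu n) t, Φ (‖f y‖ₑ / N) ≤ ENNReal.ofReal ((unitVol n * t ^ n) ^ lam) := by
  have h1 : orliczNorm Φ lam (ball (0 : Eu n) t) f < N :=
    (le_iSup₂ (f := fun (r : ℝ) (_ : 0 < r) => orliczNorm Φ lam (ball (0 : Eu n) r) f)
      t ht).trans_lt hN
  obtain ⟨ε, ⟨-, -, hε⟩, hεN⟩ := sInf_lt_iff.1 h1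
  have hV : 0 < unitVol n * t ^ n := mul_pos (unitVol_pos n) (by positivity)
  rw [volume_ball_eq _ ht, ENNReal.ofReal_rpow_of_pos hV, Real.rpow_neg hV.le,
    ENNReal.ofReal_inv_of_pos (by positivity), mul_comm, ← div_eq_mul_inv] at hε
  have h2 := (ENNReal.div_le_iff (by simpa using Real.rpow_pos_of_pos hV lam)
    ENNReal.ofReal_ne_top).1 hε
  rw [one_mul] at h2
  refine (lintegral_mono fun y => hΦ.strictMono.monotone ?_).trans h2
  exact ENNReal.div_le_div_left hεN.le _

theorem layerPotential_const_mul {n : ℕ} (θ : ℝ) (ν : Measure (Eu n)) (I : Set ℝ) {c : ℝ≥0∞}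
    (hc : c ≠ ∞) (g : Eu n → ℝ≥0∞) (x : Eu n) :
    layerPotential θ ν I (fun y => c * g y) x = c * layerPotential θ ν I g x := by
  unfold layerPotential
  rw [← lintegral_const_mul' _ _ hc]
  refine lintegral_congr fun s => ?_
  rw [lintegral_const_mul' _ _ hc, mul_left_comm]

/-- sufficiency — weak-type boundedness of the Riesz potential. -/
theorem statement15 {n : ℕ} (α : ℝ) (hα : 0 < α) (hαn : α < n)
    (Φ Ψ : ℝ≥0∞ → ℝ≥0∞) (hΦ : IsOrliczFn Φ) (hΨ : IsOrliczFn Ψ) (lam mu : ℝ)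
    (hlm : (0 < lam ∧ lam < 1 ∧ 0 < mu ∧ mu < 1 ∧ lam ≠ mu) ∨ (lam = 0 ∧ mu = 0))
    (C₄ C₅ : ℝ) (hC₄ : 1 ≤ C₄) (hC₅ : 1 ≤ C₅)
    (h4 : ∀ u : ℝ, 0 < u →
      (∫⁻ s in Ioi u,
        ENNReal.ofReal (s ^ (α / n)) * yInv Φ (ENNReal.ofReal (s ^ (lam - 1))) /
          ENNReal.ofReal s) ≤ ENNReal.ofReal C₄ * yInv Ψ (ENNReal.ofReal (u ^ (mu - 1))))
    (h5 : ∀ u : ℝ, 0 < u → ∀ r : ℝ, 0 < r →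
      (∫⁻ s in Ioi u,
        ENNReal.ofReal (s ^ (α / n)) * yInv Φ (ENNReal.ofReal (r ^ lam / s)) /
          ENNReal.ofReal s) ≤ ENNReal.ofReal C₅ * yInv Ψ (ENNReal.ofReal (r ^ mu / u))) :
    ∃ c₆ : ℝ, 1 ≤ c₆ ∧ ∀ f : Eu n → ℝ, LocallyIntegrable f volume → centralNorm Φ lam f ≠ ∞ →
      centralWeakNorm Ψ mu (riesz α f) ≤ ENNReal.ofReal c₆ * centralNorm Φ lam f := by
  have hn0 : (0 : ℝ) < n := hα.trans hαn
  have hn : n ≠ 0 := by exact_mod_cast hn0.ne'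
  have hθ : 0 < α / n := by positivity
  have hθ1 : α / n < 1 := (div_lt_one hn0).2 hαn
  have hlam : lam ≤ 1 := by rcases hlm with h | h <;> linarith [h.1, h.2]
  have hmu : mu ≤ 1 := by
    rcases hlm with h | h
    · exact h.2.2.2.1.le
    · linarith [h.2]
  have hb := unitVol_pos n
  set K : ℝ := 2 ^ (n + 1) * (12 * C₄ * C₅ / (α / n)) with hK
  have hK0 : 0 < K := by positivity
  set c : ℝ := (1 - α / n) * unitVol n ^ (1 - α / n) with hc
  have hc0 : 0 < c := mul_pos (by linarith) (by positivity)
  refine ⟨max 1 (c * K), le_max_left _ _, fun f hf _ => ?_⟩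
  suffices hmain : ∀ N, centralNorm Φ lam f < N →
      centralWeakNorm Ψ mu (riesz α f) / ENNReal.ofReal (c * K) ≤ N by
    have h1 := (ENNReal.div_le_iff (by simpa using mul_pos hc0 hK0) ENNReal.ofReal_ne_top).1
      (le_of_forall_gt_imp_ge_of_dense hmain)
    rw [mul_comm] at h1
    refine h1.trans ?_
    gcongr
    exact le_max_right _ _
  intro N hN
  rcases eq_or_ne N ∞ with rfl | hNt
  · exact le_top
  have hN0 : N ≠ 0 := (pos_of_gt hN).ne'
  rw [ENNReal.div_le_iff (by simpa using mul_pos hc0 hK0) ENNReal.ofReal_ne_top]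
  obtain ⟨f', hf'm, hff'⟩ := hf.aestronglyMeasurable
  set g : Eu n → ℝ≥0∞ := fun y => ‖f' y‖ₑ / N with hg
  have hgm : Measurable g := hf'm.enorm.div_const N
  have hfg : ∀ᵐ y, ‖f y‖ₑ = N * g y := by
    filter_upwards [hff'] with y hy
    rw [hg, hy, ENNReal.mul_div_cancel hN0 hNt]
  have hgΦ : ∀ t : ℝ, 0 < t → ∫⁻ y in ball (0 : Eu n) t, Φ (g y) ≤
      ENNReal.ofReal ((unitVol n * t ^ n) ^ lam) := fun t ht => by
    refine (lintegral_congr_ae (ae_restrict_of_ae ?_)).trans_le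
      (lintegral_ball_le_of_centralNorm_lt hΦ hN ht)
    filter_upwards [hff'] with y hy
    rw [hg, hy]
  have hriesz (x : Eu n) : ‖riesz α f x‖ₑ ≤
      ENNReal.ofReal c * N * layerPotential (α / n) volume (Ioi 0) g x := by
    rw [mul_assoc, ← layerPotential_const_mul _ _ _ hNt]
    exact enorm_riesz_le hn hαn (hgm.const_mul N) hfg x
  refine iSup₂_le fun r hr => sInf_le ⟨?_, ENNReal.mul_ne_top hNt ENNReal.ofReal_ne_top, ?_⟩
  · exact ENNReal.mul_pos hN0 (by simpa using mul_pos hc0 hK0)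
  refine iSup₂_le fun u hu => ?_
  have hNr : 0 < N.toReal := ENNReal.toReal_pos hN0 hNt
  have hu' : (0 : ℝ) < u := hu
  set σ : ℝ := u / (c * N.toReal) with hσ
  have hσ0 : 0 < σ := by positivity
  have hsub : {x ∈ ball (0 : Eu n) r | u < ‖riesz α f x‖₊} ⊆ {x ∈ ball (0 : Eu n) r |
      ENNReal.ofReal σ < layerPotential (α / n) volume (Ioi 0) g x} := fun x hx => by
    refine ⟨hx.1, ?_⟩
    have h1 : (u : ℝ≥0∞) < ‖riesz α f x‖ₑ := ENNReal.coe_lt_coe.2 hx.2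
    have h2 := h1.trans_le (hriesz x)
    rw [hσ, ENNReal.ofReal_div_of_pos (by positivity), ENNReal.ofReal_mul hc0.le,
      ENNReal.ofReal_toReal hNt, ENNReal.ofReal_coe_nnreal]
    exact ENNReal.div_lt_of_lt_mul' h2
  have key := layerPotential_weak_estimate hn hθ hθ1 hΦ hΨ hlam hmu hC₄ hC₅ h4 h5 hgm hgΦ hr hσ0
  have hV : 0 < unitVol n * r ^ n := by positivity
  have hVm : 0 < (unitVol n * r ^ n) ^ mu := by positivity
  have hε : (u : ℝ≥0∞) / (N * ENNReal.ofReal (c * K)) = ENNReal.ofReal (σ / K) := by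
    rw [hσ, div_div, ENNReal.ofReal_div_of_pos (by positivity), ENNReal.ofReal_coe_nnreal,
      mul_right_comm c, ENNReal.ofReal_mul (mul_pos hc0 hK0).le, ENNReal.ofReal_toReal hNt,
      mul_comm N]
  rw [hε, volume_ball_eq _ hr, ENNReal.ofReal_rpow_of_pos hV, Real.rpow_neg hV.le,
    ENNReal.ofReal_inv_of_pos hVm, mul_left_comm, mul_comm, ← div_eq_mul_inv]
  refine ENNReal.div_le_of_le_mul ?_
  rw [one_mul]
  exact (mul_le_mul_right (measure_mono hsub) _).trans key
end
end

section
/- Let 0 < α < n, let Φ be an Orlicz function and 0 ≤ λ < 1. Then for every u > 0, ∫_u^∞ t^{α/n} Φ⁻¹(t^{λ−1}) dt/t ≥ (ln 2 / 2^{1−λ}) · u^{α/n} Φ⁻¹(u^{λ−1}). Consequently, if there is C₄ ≥ 1 with ∫_u^∞ t^{α/n} Φ⁻¹(t^{λ−1}) dt/t ≤ C₄ Ψ⁻¹(u^{μ−1}) for all u > 0 (Ψ an Orlicz function, 0 ≤ μ < 1), then u^{α/n} Φ⁻¹(u^{λ−1}) ≤ (2^{1−λ}/ln 2) C₄ Ψ⁻¹(u^{μ−1})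 for all u > 0. -/
open MeasureTheory Metric Set Filter ENNReal NNReal Topology

noncomputable section

theorem IsOrliczFn.map_mul_le {Φ : ℝ≥0∞ → ℝ≥0∞} (hΦ : IsOrliczFn Φ) {c : ℝ≥0∞} (hc : c ≤ 1)
    (a : ℝ≥0∞) : Φ (c * a) ≤ c * Φ a := by
  simpa [hΦ.map_zero] using hΦ.convex a 0 c hc

theorem IsOrliczFn.mul_yInv_le {Φ : ℝ≥0∞ → ℝ≥0∞} (hΦ : IsOrliczFn Φ) {c : ℝ≥0∞} (hc0 : c ≠ 0)
    (hc : c ≤ 1) (v : ℝ≥0∞) : c * yInv Φ v ≤ yInv Φ (c * v) := by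
  have hct : c ≠ ∞ := ne_top_of_le_ne_top one_ne_top hc
  refine le_sInf fun w (hw : c * v < Φ w) => ?_
  rw [mul_comm, ← ENNReal.le_div_iff_mul_le (Or.inl hc0) (Or.inl hct)]
  refine sInf_le (?_ : v < Φ (w / c))
  have h := hΦ.map_mul_le hc (w / c)
  rw [ENNReal.mul_div_cancel hc0 hct] at h
  exact lt_of_mul_lt_mul_left' (hw.trans_le h)

theorem lintegral_inv_ofReal_Ioc {a b : ℝ} (ha : 0 < a) (hab : a ≤ b) :
    ∫⁻ s in Ioc a b, (ENNReal.ofReal s)⁻¹ = ENNReal.ofReal (Real.log (b / a)) := by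
  have hpos : ∀ s ∈ Ioc a b, 0 < s := fun s hs => ha.trans hs.1
  have hint : IntervalIntegrable (fun s : ℝ => s⁻¹) volume a b :=
    intervalIntegral.intervalIntegrable_inv
      (fun s hs => by rw [uIcc_of_le hab] at hs; exact (ha.trans_le hs.1).ne')
      continuousOn_id
  rw [← integral_inv_of_pos ha (ha.trans_le hab), intervalIntegral.integral_of_le hab,
    ofReal_integral_eq_lintegral_ofReal hint.1]
  · refine setLIntegral_congr_fun measurableSet_Ioc fun s hs => ?_
    simp only [ENNReal.ofReal_inv_of_pos (hpos s hs)]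
  · filter_upwards [ae_restrict_mem measurableSet_Ioc] with s hs
    exact (inv_pos.2 (hpos s hs)).le

theorem IsOrliczFn.le_lintegral_Ioi_yInv {Φ : ℝ≥0∞ → ℝ≥0∞} (hΦ : IsOrliczFn Φ) {β lam : ℝ}
    (hβ : 0 ≤ β) (hlam : lam ≤ 1) {u : ℝ} (hu : 0 < u) :
    ENNReal.ofReal (Real.log 2 / 2 ^ (1 - lam)) *
        (ENNReal.ofReal (u ^ β) * yInv Φ (ENNReal.ofReal (u ^ (lam - 1)))) ≤
      ∫⁻ s in Ioi u, ENNReal.ofReal (s ^ β) * yInv Φ (ENNReal.ofReal (s ^ (lam - 1))) /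
        ENNReal.ofReal s := by
  set c : ℝ := 2 ^ (lam - 1) with hc
  have hc0 : 0 < c := by positivity
  have hc1 : c ≤ 1 := Real.rpow_le_one_of_one_le_of_nonpos one_le_two (by linarith)
  set A := ENNReal.ofReal (u ^ β) * yInv Φ (ENNReal.ofReal (u ^ (lam - 1)))
  have hconst : Real.log 2 / 2 ^ (1 - lam) = c * Real.log 2 := by
    rw [hc, ← neg_sub 1 lam, Real.rpow_neg zero_le_two, div_eq_inv_mul]
  have hlog : ∫⁻ s in Ioc u (2 * u), (ENNReal.ofReal s)⁻¹ = ENNReal.ofReal (Real.log 2) := by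
    rw [lintegral_inv_ofReal_Ioc hu (by linarith), mul_div_cancel_right₀ _ hu.ne']
  calc ENNReal.ofReal (Real.log 2 / 2 ^ (1 - lam)) * A
      = ENNReal.ofReal c * A * ∫⁻ s in Ioc u (2 * u), (ENNReal.ofReal s)⁻¹ := by
        rw [hconst, hlog, ENNReal.ofReal_mul hc0.le]; ring
    _ = ∫⁻ s in Ioc u (2 * u), ENNReal.ofReal c * A * (ENNReal.ofReal s)⁻¹ :=
        (lintegral_const_mul _ (by fun_prop)).symm
    _ ≤ ∫⁻ s in Ioc u (2 * u), ENNReal.ofReal (s ^ β) *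
          yInv Φ (ENNReal.ofReal (s ^ (lam - 1))) / ENNReal.ofReal s := by
        refine setLIntegral_mono' measurableSet_Ioc fun s hs => ?_
        have hs0 : 0 < s := hu.trans hs.1
        have hpow : c * u ^ (lam - 1) ≤ s ^ (lam - 1) := by
          rw [hc, ← Real.mul_rpow zero_le_two hu.le]
          exact Real.rpow_le_rpow_of_nonpos hs0 hs.2 (by linarith)
        have hinv : ENNReal.ofReal c * yInv Φ (ENNReal.ofReal (u ^ (lam - 1))) ≤
            yInv Φ (ENNReal.ofReal (s ^ (lam - 1))) := by
          refine (hΦ.mul_yInv_le (by simpa using hc0) (by simpa using hc1) _).trans ?_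
          rw [← ENNReal.ofReal_mul hc0.le]
          exact yInv_mono Φ (ENNReal.ofReal_le_ofReal hpow)
        rw [div_eq_mul_inv, mul_left_comm]
        gcongr
        exact hs.1.le
    _ ≤ _ := lintegral_mono_set Ioc_subset_Ioi_self

/-- lower bound for the tail integral, and its consequence. -/
theorem statement16 {n : ℕ} (α : ℝ) (hα : 0 < α) (hαn : α < n)
    (Φ : ℝ≥0∞ → ℝ≥0∞) (hΦ : IsOrliczFn Φ) (lam : ℝ) (hlam0 : 0 ≤ lam) (hlam1 : lam < 1) :
    (∀ u : ℝ, 0 < u →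
      ENNReal.ofReal (Real.log 2 / 2 ^ (1 - lam)) *
          (ENNReal.ofReal (u ^ (α / n)) * yInv Φ (ENNReal.ofReal (u ^ (lam - 1)))) ≤
        ∫⁻ s in Ioi u,
          ENNReal.ofReal (s ^ (α / n)) * yInv Φ (ENNReal.ofReal (s ^ (lam - 1))) /
            ENNReal.ofReal s) ∧
    (∀ Ψ : ℝ≥0∞ → ℝ≥0∞, IsOrliczFn Ψ → ∀ mu : ℝ, 0 ≤ mu → mu < 1 → ∀ C₄ : ℝ, 1 ≤ C₄ →
      (∀ u : ℝ, 0 < u →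
        (∫⁻ s in Ioi u,
          ENNReal.ofReal (s ^ (α / n)) * yInv Φ (ENNReal.ofReal (s ^ (lam - 1))) /
            ENNReal.ofReal s) ≤ ENNReal.ofReal C₄ * yInv Ψ (ENNReal.ofReal (u ^ (mu - 1)))) →
      ∀ u : ℝ, 0 < u →
        ENNReal.ofReal (u ^ (α / n)) * yInv Φ (ENNReal.ofReal (u ^ (lam - 1))) ≤
          ENNReal.ofReal (2 ^ (1 - lam) / Real.log 2 * C₄) *
            yInv Ψ (ENNReal.ofReal (u ^ (mu - 1)))) := by
  have hβ : 0 ≤ α / n := div_nonneg hα.le n.cast_nonneg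
  refine ⟨fun u hu => hΦ.le_lintegral_Ioi_yInv hβ hlam1.le hu, ?_⟩
  intro Ψ _ mu _ _ C₄ _ h u hu
  have hlog : 0 < Real.log 2 := Real.log_pos one_lt_two
  have hD : 0 < (2 : ℝ) ^ (1 - lam) := by positivity
  have hone : ENNReal.ofReal (2 ^ (1 - lam) / Real.log 2) *
      ENNReal.ofReal (Real.log 2 / 2 ^ (1 - lam)) = 1 := by
    rw [← ENNReal.ofReal_mul (by positivity), div_mul_div_cancel₀ hlog.ne', div_self hD.ne',
      ENNReal.ofReal_one]
  rw [ENNReal.ofReal_mul (by positivity), mul_assoc]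
  refine le_trans (le_of_eq ?_)
    (mul_le_mul_right ((hΦ.le_lintegral_Ioi_yInv hβ hlam1.le hu).trans (h u hu)) _)
  rw [← mul_assoc, hone, one_mul]
end
end

section
/- Let 0 < α < n, 0 ≤ λ < 1, 1 < p < n(1−λ)/α, and define q and μ by 1/q = 1/p − α/n and λ/p = μ/q. Then the Riesz potential I_α is bounded from the central Morrey space M^{p,λ}(0) to M^{q,μ}(0): there is a constant C ≥ 1 such that ‖I_α f‖_{M^{q,μ}(0)} ≤ C ‖f‖_{M^{p,λ}(0)} for all f ∈ M^{p,λ}(0). -/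
open MeasureTheory Metric Set Filter ENNReal NNReal Topology

noncomputable section

lemma lintegral_Ioi_rpow_neg {b ρ : ℝ} (hb : 0 < b) (hρ : 0 < ρ) :
    ∫⁻ t in Ioi ρ, ENNReal.ofReal (t ^ (-b - 1)) = ENNReal.ofReal (ρ ^ (-b) / b) := by
  rw [← ofReal_integral_eq_lintegral_ofReal (integrableOn_Ioi_rpow_of_lt (by linarith) hρ),
    integral_Ioi_rpow_of_lt (by linarith) hρ]
  · congr 1
    rw [sub_add_cancel, neg_div_neg_eq]
  · filter_upwards [ae_restrict_mem measurableSet_Ioi] with t ht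
    exact Real.rpow_nonneg (hρ.trans ht).le _

lemma lintegral_Ioo_rpow {a b : ℝ} (ha : 0 ≤ a) (hb : 0 < b) :
    ∫⁻ t in Ioo 0 a, ENNReal.ofReal (t ^ (b - 1)) = ENNReal.ofReal (a ^ b / b) := by
  have hint : IntervalIntegrable (fun t : ℝ ↦ t ^ (b - 1)) volume 0 a :=
    intervalIntegral.intervalIntegrable_rpow' (by linarith)
  rw [restrict_Ioo_eq_restrict_Ioc, ← ofReal_integral_eq_lintegral_ofReal hint.1,
    ← intervalIntegral.integral_of_le ha, integral_rpow (Or.inl (by linarith))]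
  · simp [Real.zero_rpow hb.ne']
  · filter_upwards [ae_restrict_mem measurableSet_Ioc] with t ht
    exact Real.rpow_nonneg ht.1.le _

/-- Layer cake formula for a single power. -/
lemma lintegral_Ioi_ite_rpow {b : ℝ} (hb : 0 < b) (x : ℝ≥0∞) :
    ∫⁻ t in Ioi (0 : ℝ), (if ENNReal.ofReal t < x then ENNReal.ofReal (t ^ (b - 1)) else 0)
      = x ^ b * ENNReal.ofReal (1 / b) := by
  have key (a : ℝ≥0) : ∫⁻ t in Ioi (0 : ℝ),
      (if ENNReal.ofReal t < a then ENNReal.ofReal (t ^ (b - 1)) else 0)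
      = (a : ℝ≥0∞) ^ b * ENNReal.ofReal (1 / b) := by
    calc _ = ∫⁻ t in Ioi (0 : ℝ), (Ioo 0 (a : ℝ)).indicator
          (fun t ↦ ENNReal.ofReal (t ^ (b - 1))) t := by
          refine setLIntegral_congr_fun measurableSet_Ioi fun t (ht : 0 < t) ↦ ?_
          have : ENNReal.ofReal t < a ↔ t < a := by
            rw [← ENNReal.ofReal_coe_nnreal, ENNReal.ofReal_lt_ofReal_iff_of_nonneg ht.le]
          simp [indicator, this, ht]
      _ = ∫⁻ t in Ioo 0 (a : ℝ), ENNReal.ofReal (t ^ (b - 1)) := by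
          rw [lintegral_indicator measurableSet_Ioo,
            Measure.restrict_restrict measurableSet_Ioo,
            inter_eq_left.2 Ioo_subset_Ioi_self]
      _ = _ := by
          rw [lintegral_Ioo_rpow a.coe_nonneg hb, div_eq_mul_one_div, ENNReal.ofReal_mul (by positivity),
            ← ENNReal.ofReal_rpow_of_nonneg a.coe_nonneg hb.le]
          simp
  induction x using ENNReal.recTopCoe with
  | coe a => exact key a
  | top =>
    have hb' : ENNReal.ofReal (1 / b) ≠ 0 := by simpa using hb
    rw [ENNReal.top_rpow_of_pos hb, ENNReal.top_mul hb']
    refine ENNReal.eq_top_of_forall_nnreal_le fun r ↦ ?_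
    have hr : (r : ℝ≥0∞) = ((r * b.toNNReal) ^ (1 / b) : ℝ≥0) ^ b * ENNReal.ofReal (1 / b) := by
      rw [← ENNReal.coe_rpow_of_nonneg _ hb.le, ← NNReal.rpow_mul, one_div_mul_cancel hb.ne',
        NNReal.rpow_one, ENNReal.ofReal, ← ENNReal.coe_mul]
      congr 1
      rw [mul_assoc, ← Real.toNNReal_mul hb.le, mul_one_div_cancel hb.ne']
      simp
    rw [hr, ← key]
    refine lintegral_mono fun t ↦ ?_
    split_ifs <;> simp_all

lemma volume_ball_eu {n : ℕ} (hn : n ≠ 0) {t : ℝ} (ht : 0 ≤ t) :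
    volume (ball (0 : Eu n) t) = volume (ball (0 : Eu n) 1) * ENNReal.ofReal (t ^ (n : ℝ)) := by
  have : Nonempty (Fin n) := ⟨⟨0, Nat.pos_of_ne_zero hn⟩⟩
  rw [Measure.addHaar_ball _ _ ht, mul_comm]
  simp

lemma lintegral_mul_norm_rpow_neg_le {n : ℕ} {b : ℝ} (hb : 0 < b) {g : Eu n → ℝ≥0∞}
    (hg : Measurable g) :
    ∫⁻ y, g y * ENNReal.ofReal (‖y‖ ^ (-b)) ≤
      ENNReal.ofReal b * ∫⁻ t in Ioi (0 : ℝ),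
        ENNReal.ofReal (t ^ (-b - 1)) * ∫⁻ y in ball (0 : Eu n) t, g y := by
  have hmeas : Measurable fun z : Eu n × ℝ ↦
      if ‖z.1‖ < z.2 then g z.1 * ENNReal.ofReal (z.2 ^ (-b - 1)) else 0 :=
    Measurable.ite (measurableSet_lt (by fun_prop) (by fun_prop)) (by fun_prop) (by fun_prop)
  calc _ ≤ ∫⁻ y, ENNReal.ofReal b * ∫⁻ t in Ioi (0 : ℝ),
        (if ‖y‖ < t then g y * ENNReal.ofReal (t ^ (-b - 1)) else 0) := by
        refine lintegral_mono fun y ↦ ?_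
        rcases (norm_nonneg y).eq_or_lt with h0 | h0
        · simp [← h0, Real.zero_rpow (neg_ne_zero.2 hb.ne')]
        refine le_of_eq ?_
        calc _ = ENNReal.ofReal b * (g y * ENNReal.ofReal (‖y‖ ^ (-b) / b)) := by
              rw [mul_left_comm, ← ENNReal.ofReal_mul hb.le, mul_div_cancel₀ _ hb.ne']
          _ = ENNReal.ofReal b * ∫⁻ t in Ioi ‖y‖, g y * ENNReal.ofReal (t ^ (-b - 1)) := by
              rw [lintegral_const_mul _ (by fun_prop), lintegral_Ioi_rpow_neg hb h0]
          _ = ENNReal.ofReal b * ∫⁻ t in Ioi 0, (Ioi ‖y‖).indicator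
                (fun t ↦ g y * ENNReal.ofReal (t ^ (-b - 1))) t := by
              rw [lintegral_indicator measurableSet_Ioi,
                Measure.restrict_restrict measurableSet_Ioi,
                inter_eq_left.2 (Ioi_subset_Ioi h0.le)]
          _ = _ := by simp [indicator]
    _ = ENNReal.ofReal b * ∫⁻ t in Ioi (0 : ℝ), ∫⁻ y,
        (if ‖y‖ < t then g y * ENNReal.ofReal (t ^ (-b - 1)) else 0) := by
        rw [lintegral_const_mul _ (Measurable.lintegral_prod_right' hmeas),
          lintegral_lintegral_swap hmeas.aemeasurable]
    _ = _ := by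
        congr 1
        refine lintegral_congr fun t ↦ ?_
        rw [← lintegral_const_mul _ hg, ← lintegral_indicator measurableSet_ball]
        refine lintegral_congr fun y ↦ ?_
        simp [indicator, mul_comm]

lemma setLIntegral_compl_ball_mul_norm_rpow_neg_le {n : ℕ} {b c ρ : ℝ} (hb : 0 < b) (hcb : c < b)
    (hρ : 0 < ρ) {g : Eu n → ℝ≥0∞} (hg : Measurable g) {A : ℝ≥0∞}
    (hA : ∀ t, ρ < t → ∫⁻ y in ball (0 : Eu n) t, g y ≤ A * ENNReal.ofReal (t ^ c)) :
    ∫⁻ y in (ball (0 : Eu n) ρ)ᶜ, g y * ENNReal.ofReal (‖y‖ ^ (-b)) ≤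
      A * ENNReal.ofReal (b / (b - c) * ρ ^ (c - b)) := by
  have hS : MeasurableSet (ball (0 : Eu n) ρ)ᶜ := measurableSet_ball.compl
  have hbc : 0 < b - c := sub_pos.2 hcb
  calc _ = ∫⁻ y, (ball (0 : Eu n) ρ)ᶜ.indicator g y * ENNReal.ofReal (‖y‖ ^ (-b)) := by
        rw [← lintegral_indicator hS]
        simp only [indicator_mul_left]
    _ ≤ ENNReal.ofReal b * ∫⁻ t in Ioi (0 : ℝ), ENNReal.ofReal (t ^ (-b - 1)) *
          ∫⁻ y in ball (0 : Eu n) t, (ball (0 : Eu n) ρ)ᶜ.indicator g y :=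
        lintegral_mul_norm_rpow_neg_le hb (hg.indicator hS)
    _ ≤ ENNReal.ofReal b * ∫⁻ t in Ioi (0 : ℝ), (Ioi ρ).indicator
          (fun t ↦ A * ENNReal.ofReal (t ^ (-(b - c) - 1))) t := by
        refine mul_le_mul' le_rfl
          (setLIntegral_mono' measurableSet_Ioi fun t (ht : 0 < t) ↦ ?_)
        by_cases h : ρ < t
        · rw [indicator_of_mem (mem_Ioi.2 h)]
          calc _ ≤ ENNReal.ofReal (t ^ (-b - 1)) * (A * ENNReal.ofReal (t ^ c)) := by
                gcongr
                exact (lintegral_mono fun y ↦ indicator_le_self _ _ _).trans (hA t h)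
            _ = _ := by
                rw [mul_left_comm, ← ENNReal.ofReal_mul (by positivity), ← Real.rpow_add ht]
                ring_nf
        · rw [indicator_of_notMem (by simpa using h), lintegral_indicator hS,
            Measure.restrict_restrict hS, (disjoint_compl_left_iff_subset.2
              (ball_subset_ball (not_lt.1 h))).inter_eq]
          simp
    _ = _ := by
        rw [lintegral_indicator measurableSet_Ioi, Measure.restrict_restrict measurableSet_Ioi,
          inter_eq_left.2 (Ioi_subset_Ioi hρ.le), lintegral_const_mul _ (by fun_prop),
          lintegral_Ioi_rpow_neg hbc hρ, mul_left_comm, ← ENNReal.ofReal_mul hb.le]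
        congr 2
        rw [neg_sub]
        ring

lemma setLIntegral_ball_norm_rpow_neg_le {n : ℕ} (hn : n ≠ 0) {b R : ℝ} (hb : 0 < b)
    (hbn : b < n) (hR : 0 < R) :
    ∫⁻ y in ball (0 : Eu n) R, ENNReal.ofReal (‖y‖ ^ (-b)) ≤
      volume (ball (0 : Eu n) 1) * ENNReal.ofReal ((b / (n - b) + 1) * R ^ ((n : ℝ) - b)) := by
  have hnb : 0 < (n : ℝ) - b := sub_pos.2 hbn
  set v := volume (ball (0 : Eu n) 1)
  calc _ = ∫⁻ y, (ball (0 : Eu n) R).indicator 1 y * ENNReal.ofReal (‖y‖ ^ (-b)) := by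
        rw [← lintegral_indicator measurableSet_ball]
        simp [indicator]
    _ ≤ ENNReal.ofReal b * ∫⁻ t in Ioi (0 : ℝ), ENNReal.ofReal (t ^ (-b - 1)) *
          ∫⁻ y in ball (0 : Eu n) t, (ball (0 : Eu n) R).indicator 1 y :=
        lintegral_mul_norm_rpow_neg_le hb (measurable_one.indicator measurableSet_ball)
    _ ≤ ENNReal.ofReal b * ∫⁻ t in Ioi (0 : ℝ), (v *
          (Ioo 0 R).indicator (fun t ↦ ENNReal.ofReal (t ^ ((n : ℝ) - b - 1))) t +
          v * ENNReal.ofReal (R ^ (n : ℝ)) *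
            (Ici R).indicator (fun t ↦ ENNReal.ofReal (t ^ (-b - 1))) t) := by
        refine mul_le_mul' le_rfl
          (setLIntegral_mono' measurableSet_Ioi fun t (ht : 0 < t) ↦ ?_)
        rw [lintegral_indicator measurableSet_ball, Measure.restrict_restrict measurableSet_ball]
        simp only [Pi.one_apply, lintegral_one, Measure.restrict_apply_univ]
        by_cases h : t < R
        · rw [indicator_of_mem (show t ∈ Ioo 0 R from ⟨ht, h⟩),
            indicator_of_notMem (by simpa using h), mul_zero, add_zero]
          calc _ ≤ ENNReal.ofReal (t ^ (-b - 1)) * (v * ENNReal.ofReal (t ^ (n : ℝ))) := by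
                gcongr
                rw [← volume_ball_eu hn ht.le]
                exact measure_mono inter_subset_right
            _ = _ := by
                rw [mul_left_comm, ← ENNReal.ofReal_mul (by positivity), ← Real.rpow_add ht]
                ring_nf
        · rw [indicator_of_notMem (by simp [h]), indicator_of_mem (mem_Ici.2 (not_lt.1 h)),
            mul_zero, zero_add, mul_comm]
          gcongr
          rw [← volume_ball_eu hn hR.le]
          exact measure_mono inter_subset_left
    _ = _ := by
        rw [lintegral_add_left (by measurability), lintegral_const_mul _ (by measurability),
          lintegral_const_mul _ (by measurability),
          lintegral_indicator measurableSet_Ioo, Measure.restrict_restrict measurableSet_Ioo,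
          lintegral_indicator measurableSet_Ici, Measure.restrict_restrict measurableSet_Ici,
          inter_eq_left.2 Ioo_subset_Ioi_self, inter_eq_left.2 (Ici_subset_Ioi.2 hR),
          lintegral_Ioo_rpow hR.le hnb, ← restrict_Ioi_eq_restrict_Ici,
          lintegral_Ioi_rpow_neg hb hR, mul_assoc, ← mul_add, mul_left_comm,
          ← ENNReal.ofReal_mul (by positivity), ← ENNReal.ofReal_add (by positivity) (by positivity),
          ← ENNReal.ofReal_mul (by positivity)]
        congr 2
        rw [← mul_div_assoc (R ^ (n : ℝ)), ← Real.rpow_add hR, ← sub_eq_add_neg]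
        field_simp

/-- The Riesz potential `∫ g(y) |x-y|^{-b} dy` of a nonnegative function. -/
def lriesz {n : ℕ} (b : ℝ) (g : Eu n → ℝ≥0∞) (x : Eu n) : ℝ≥0∞ :=
  ∫⁻ y, g y * ENNReal.ofReal (‖x - y‖ ^ (-b))

lemma measurable_lriesz {n : ℕ} (b : ℝ) {g : Eu n → ℝ≥0∞} (hg : Measurable g) :
    Measurable (lriesz b g) := by
  have h : Measurable fun z : Eu n × Eu n ↦ g z.2 * ENNReal.ofReal (‖z.1 - z.2‖ ^ (-b)) := by
    fun_prop
  exact h.lintegral_prod_right'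

lemma lintegral_mul_compl_ball_kernel_le {n : ℕ} (hn : n ≠ 0) {b p p' R : ℝ}
    (hpp : p.HolderConjugate p') (hb : 0 < b) (hbp : n < b * p') (hR : 0 < R)
    {g : Eu n → ℝ≥0∞} (hg : Measurable g) (x : Eu n) :
    ∫⁻ y, g y * (ball (0 : Eu n) R)ᶜ.indicator (fun z ↦ ENNReal.ofReal (‖z‖ ^ (-b))) (x - y) ≤
      (∫⁻ y, g y ^ p) ^ (1 / p) *
        ((volume (ball (0 : Eu n) 1) * ENNReal.ofReal (b * p' / (b * p' - n))) ^ (1 / p') *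
          ENNReal.ofReal (R ^ (n / p' - b))) := by
  have hp' : 0 < p' := hpp.symm.pos
  have hS : MeasurableSet (ball (0 : Eu n) R)ᶜ := measurableSet_ball.compl
  have hk : Measurable ((ball (0 : Eu n) R)ᶜ.indicator fun z ↦ ENNReal.ofReal (‖z‖ ^ (-b))) :=
    Measurable.indicator (by fun_prop) hS
  have hd : 0 < b * p' - n := sub_pos.2 hbp
  refine (ENNReal.lintegral_mul_le_Lp_mul_Lq volume hpp hg.aemeasurable
    (hk.comp (measurable_const.sub measurable_id)).aemeasurable).trans
    (mul_le_mul' le_rfl ?_)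
  calc _ = (∫⁻ z, ((ball (0 : Eu n) R)ᶜ.indicator
          (fun z ↦ ENNReal.ofReal (‖z‖ ^ (-b))) z) ^ p') ^ (1 / p') := by
        congr 1
        exact lintegral_sub_left_eq_self (fun z ↦ ((ball (0 : Eu n) R)ᶜ.indicator
          (fun z ↦ ENNReal.ofReal (‖z‖ ^ (-b))) z) ^ p') x
    _ = (∫⁻ z in (ball (0 : Eu n) R)ᶜ, 1 * ENNReal.ofReal (‖z‖ ^ (-(b * p')))) ^ (1 / p') := by
        rw [← lintegral_indicator hS]
        congr 1
        refine lintegral_congr fun z ↦ ?_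
        by_cases hz : z ∈ (ball (0 : Eu n) R)ᶜ
        · rw [indicator_of_mem hz, indicator_of_mem hz, one_mul,
            ENNReal.ofReal_rpow_of_nonneg (by positivity) hp'.le,
            ← Real.rpow_mul (norm_nonneg _), neg_mul]
        · rw [indicator_of_notMem hz, indicator_of_notMem hz, ENNReal.zero_rpow_of_pos hp']
    _ ≤ (volume (ball (0 : Eu n) 1) *
          ENNReal.ofReal (b * p' / (b * p' - n) * R ^ ((n : ℝ) - b * p'))) ^ (1 / p') := by
        gcongr
        refine setLIntegral_compl_ball_mul_norm_rpow_neg_le (by positivity) hbp hR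
          measurable_const fun t ht ↦ ?_
        rw [← volume_ball_eu hn (hR.trans ht).le]
        simp
    _ = _ := by
        rw [ENNReal.ofReal_mul (by positivity), ← mul_assoc,
          ENNReal.mul_rpow_of_nonneg _ _ (by positivity),
          ENNReal.ofReal_rpow_of_nonneg (by positivity) (by positivity), ← Real.rpow_mul hR.le]
        congr 3
        field_simp

lemma lintegral_ball_kernel_le {n : ℕ} (hn : n ≠ 0) {b R : ℝ} (hb : 0 < b) (hbn : b < n)
    (hR : 0 < R) (y : Eu n) :
    ∫⁻ x, (ball (0 : Eu n) R).indicator (fun z ↦ ENNReal.ofReal (‖z‖ ^ (-b))) (x - y) ≤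
      volume (ball (0 : Eu n) 1) * ENNReal.ofReal (b / (n - b) + 1) *
        ENNReal.ofReal (R ^ ((n : ℝ) - b)) := by
  have hnb : 0 < (n : ℝ) - b := sub_pos.2 hbn
  rw [lintegral_sub_right_eq_self, lintegral_indicator measurableSet_ball, mul_assoc,
    ← ENNReal.ofReal_mul (by positivity)]
  exact setLIntegral_ball_norm_rpow_neg_le hn hb hbn hR

/-- Distributional estimate behind the Hardy–Littlewood–Sobolev inequality. -/
lemma volume_lt_lriesz_le {n : ℕ} (hn : n ≠ 0) {b p p' q : ℝ}
    (hpp : p.HolderConjugate p') (hb : 0 < b) (hbn : b < n) (hq : 0 < q)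
    (hpq : 1 / q = 1 / p - (n - b) / n) {g : Eu n → ℝ≥0∞} (hg : Measurable g)
    (hg1 : ∫⁻ y, g y ^ p ≤ 1) {c₁ c₂ : ℝ≥0∞}
    (hc₁ : c₁ = volume (ball (0 : Eu n) 1) * ENNReal.ofReal (b / (n - b) + 1))
    (hc₂ : c₂ = (volume (ball (0 : Eu n) 1) * ENNReal.ofReal (b * p' / (b * p' - n))) ^ (1 / p'))
    {s : ℝ} (hs : 0 < s) :
    volume {x | (c₁ + c₂ + 1) * ENNReal.ofReal s < lriesz b g x} ≤
      c₁ * ENNReal.ofReal (s ^ (-(q / p))) *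
        ∫⁻ y, (if ENNReal.ofReal (s ^ (q / p)) < g y then g y else 0) := by
  have hn0 : (0 : ℝ) < n := hb.trans hbn
  have hp : 0 < p := hpp.pos
  have hp' : 0 < p' := hpp.symm.pos
  have hpinv : 1 / p' = 1 - 1 / p := by
    have := hpp.inv_add_inv_eq_one
    simp only [one_div]
    linarith
  have hexp : n / p' - b = -(n / q) := by
    have h1 : n / p' = n * (1 - 1 / p) := by rw [← hpinv]; ring
    have h2 : n / q = n * (1 / p - (n - b) / n) := by rw [← hpq]; ring
    rw [h1, h2]
    field_simp
    ring
  have hbp : n < b * p' := by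
    have : n / p' < b := by linarith [div_pos hn0 hq]
    rwa [div_lt_iff₀ hp'] at this
  set h := ENNReal.ofReal (s ^ (q / p)) with hh
  set R : ℝ := s ^ (-(q / n)) with hRdef
  have hR : 0 < R := Real.rpow_pos_of_pos hs _
  set K : Eu n → ℝ≥0∞ := fun z ↦ ENNReal.ofReal (‖z‖ ^ (-b)) with hK
  have hKm : Measurable K := by fun_prop
  set K₀ := (ball (0 : Eu n) R).indicator K
  set K₁ := (ball (0 : Eu n) R)ᶜ.indicator K
  have hK₀ : Measurable K₀ := hKm.indicator measurableSet_ball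
  have hK₁ : Measurable K₁ := hKm.indicator measurableSet_ball.compl
  set g₁ : Eu n → ℝ≥0∞ := fun y ↦ if h < g y then g y else 0
  have hg₁ : Measurable g₁ :=
    Measurable.ite (measurableSet_lt measurable_const hg) hg measurable_const
  set F : Eu n → ℝ≥0∞ := fun x ↦ ∫⁻ y, g₁ y * K₀ (x - y)
  have hFm : Measurable fun z : Eu n × Eu n ↦ g₁ z.2 * K₀ (z.1 - z.2) := by fun_prop
  have hF : Measurable F := hFm.lintegral_prod_right'
  have hqn : -(q / n) * (n - b) + q / p = 1 := by
    have h2 : q * (1 / q) = q * (1 / p - (n - b) / n) := by rw [hpq]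
    rw [mul_one_div_cancel hq.ne'] at h2
    rw [h2]
    ring
  have hR0 : R ^ ((n : ℝ) - b) = s * s ^ (-(q / p)) := by
    rw [hRdef, ← Real.rpow_mul hs.le]
    nth_rewrite 2 [← Real.rpow_one s]
    rw [← Real.rpow_add hs]
    congr 1
    linarith
  have hpt (x : Eu n) : lriesz b g x ≤ (c₁ + c₂) * ENNReal.ofReal s + F x := by
    calc lriesz b g x ≤ ∫⁻ y, (h * K₀ (x - y) + g y * K₁ (x - y) + g₁ y * K₀ (x - y)) := by
          refine lintegral_mono fun y ↦ ?_
          change g y * K (x - y) ≤ _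
          by_cases hz : x - y ∈ ball (0 : Eu n) R
          · rw [show K₀ (x - y) = K (x - y) from indicator_of_mem hz _, add_right_comm, ← add_mul]
            refine le_add_right (mul_le_mul' ?_ le_rfl)
            by_cases hy : h < g y
            · simp [g₁, hy]
            · exact le_add_right (not_lt.1 hy)
          · rw [show K₁ (x - y) = K (x - y) from indicator_of_mem hz _]
            exact le_add_right (le_add_left le_rfl)
      _ = h * (∫⁻ y, K₀ (x - y)) + (∫⁻ y, g y * K₁ (x - y)) + F x := by
          rw [lintegral_add_left (by fun_prop), lintegral_add_left (by fun_prop),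
            lintegral_const_mul _ (by fun_prop)]
      _ ≤ h * (c₁ * ENNReal.ofReal (R ^ ((n : ℝ) - b))) +
            (1 * (c₂ * ENNReal.ofReal (R ^ (n / p' - b)))) + F x := by
          gcongr
          · have h3 := lintegral_ball_kernel_le hn hb hbn hR (0 : Eu n)
            rw [← hc₁] at h3
            simp only [sub_zero] at h3
            rwa [lintegral_sub_left_eq_self]
          · refine (lintegral_mul_compl_ball_kernel_le hn hpp hb hbp hR hg x).trans ?_
            rw [← hc₂]
            gcongr
            exact ENNReal.rpow_le_one hg1 (by positivity)
      _ = _ := by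
          congr 1
          have e1 : R ^ (n / p' - b) = s := by
            rw [hexp, hRdef, ← Real.rpow_mul hs.le]
            nth_rewrite 2 [← Real.rpow_one s]
            congr 1
            field_simp
          have e2 : s ^ (q / p) * R ^ ((n : ℝ) - b) = s := by
            rw [hR0, mul_left_comm, ← Real.rpow_add hs]
            simp
          rw [mul_left_comm, hh, ← ENNReal.ofReal_mul (by positivity), e1, e2, one_mul, add_mul]
  have hs0 : ENNReal.ofReal s ≠ 0 := by simpa using hs
  calc _ ≤ volume {x | ENNReal.ofReal s ≤ F x} := by
        refine measure_mono fun x hx ↦ ?_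
        have h4 := (show _ < lriesz b g x from hx).trans_le (hpt x)
        rw [add_mul _ 1, one_mul] at h4
        exact (lt_of_add_lt_add_left h4).le
    _ ≤ (∫⁻ x, F x) / ENNReal.ofReal s :=
        meas_ge_le_lintegral_div hF.aemeasurable hs0 ENNReal.ofReal_ne_top
    _ = (∫⁻ y, g₁ y * ∫⁻ x, K₀ (x - y)) / ENNReal.ofReal s := by
        rw [lintegral_lintegral_swap hFm.aemeasurable]
        congr 1
        refine lintegral_congr fun y ↦ ?_
        rw [lintegral_const_mul _ (by fun_prop)]
    _ ≤ (∫⁻ y, g₁ y * (c₁ * ENNReal.ofReal (R ^ ((n : ℝ) - b)))) / ENNReal.ofReal s := by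
        gcongr with y
        rw [hc₁]
        exact lintegral_ball_kernel_le hn hb hbn hR y
    _ = _ := by
        rw [lintegral_mul_const _ hg₁, hR0, ENNReal.ofReal_mul hs.le, ENNReal.div_eq_inv_mul,
          mul_left_comm c₁, mul_left_comm (∫⁻ y, g₁ y), ← mul_assoc (ENNReal.ofReal s)⁻¹,
          ENNReal.inv_mul_cancel hs0 ENNReal.ofReal_ne_top, one_mul, mul_comm]

/-- Hardy–Littlewood–Sobolev inequality, normalized form. -/
lemma lintegral_lriesz_rpow_le_of_le_one {n : ℕ} (hn : n ≠ 0) {b p q : ℝ}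
    (hp1 : 1 < p) (hb : 0 < b) (hbn : b < n) (hq : 0 < q)
    (hpq : 1 / q = 1 / p - (n - b) / n) :
    ∃ C : ℝ≥0∞, C ≠ ∞ ∧ ∀ g : Eu n → ℝ≥0∞, Measurable g → ∫⁻ y, g y ^ p ≤ 1 →
      ∫⁻ x, lriesz b g x ^ q ≤ C := by
  have hp : 0 < p := by linarith
  have hpp := Real.HolderConjugate.conjExponent hp1
  set p' := p.conjExponent
  obtain ⟨c₁, hc₁⟩ : ∃ c₁, c₁ = volume (ball (0 : Eu n) 1) * ENNReal.ofReal (b / (n - b) + 1) :=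
    ⟨_, rfl⟩
  obtain ⟨c₂, hc₂⟩ : ∃ c₂, c₂ = (volume (ball (0 : Eu n) 1) *
    ENNReal.ofReal (b * p' / (b * p' - n))) ^ (1 / p') := ⟨_, rfl⟩
  have hv : volume (ball (0 : Eu n) 1) ≠ ∞ := measure_ball_lt_top.ne
  have hc₁t : c₁ ≠ ∞ := by
    rw [hc₁]; exact ENNReal.mul_ne_top hv ENNReal.ofReal_ne_top
  have hc₂t : c₂ ≠ ∞ := by
    rw [hc₂]
    exact ENNReal.rpow_ne_top_of_nonneg (one_div_nonneg.2 hpp.symm.nonneg)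
      (ENNReal.mul_ne_top hv ENNReal.ofReal_ne_top)
  set M := c₁ + c₂ + 1 with hM
  have hMt : M ≠ ∞ := by simp [hM, hc₁t, hc₂t]
  have hM0 : M ≠ 0 := by simp [hM]
  set d := q - q / p with hd
  have hd0 : 0 < d := sub_pos.2 (div_lt_self hq hp1)
  refine ⟨M ^ q * (ENNReal.ofReal q * (c₁ * ENNReal.ofReal (1 / d))), ?_, fun g hg hg1 ↦ ?_⟩
  · refine ENNReal.mul_ne_top (ENNReal.rpow_ne_top_of_nonneg hq.le hMt) ?_
    exact ENNReal.mul_ne_top ENNReal.ofReal_ne_top (ENNReal.mul_ne_top hc₁t ENNReal.ofReal_ne_top)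
  set G : Eu n → ℝ≥0∞ := fun x ↦ M⁻¹ * lriesz b g x with hG
  have hGm : Measurable G := (measurable_lriesz b hg).const_mul _
  have hJG (x) : lriesz b g x = M * G x := by
    rw [hG, ← mul_assoc, ENNReal.mul_inv_cancel hM0 hMt, one_mul]
  have hm1 : Measurable fun z : Eu n × ℝ ↦
      if ENNReal.ofReal z.2 < G z.1 then ENNReal.ofReal (z.2 ^ (q - 1)) else 0 :=
    Measurable.ite (measurableSet_lt (by fun_prop) (by fun_prop)) (by fun_prop) (by fun_prop)
  have hm2 : Measurable fun z : ℝ × Eu n ↦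
      (if ENNReal.ofReal (z.1 ^ (q / p)) < g z.2 then g z.2 else 0) *
        ENNReal.ofReal (z.1 ^ (d - 1)) :=
    (Measurable.ite (measurableSet_lt (by fun_prop) (by fun_prop)) (by fun_prop)
      (by fun_prop)).mul (by fun_prop)
  have hq' : ENNReal.ofReal q * ENNReal.ofReal (1 / q) = 1 := by
    rw [← ENNReal.ofReal_mul hq.le, mul_one_div_cancel hq.ne', ENNReal.ofReal_one]
  have hlevel : ∫⁻ x, G x ^ q * ENNReal.ofReal (1 / q) ≤
      c₁ * ENNReal.ofReal (1 / d) := by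
    calc ∫⁻ x, G x ^ q * ENNReal.ofReal (1 / q)
        = ∫⁻ x, ∫⁻ t in Ioi (0 : ℝ),
          (if ENNReal.ofReal t < G x then ENNReal.ofReal (t ^ (q - 1)) else 0) := by
          simp only [lintegral_Ioi_ite_rpow hq]
      _ = ∫⁻ t in Ioi (0 : ℝ), ∫⁻ x,
          (if ENNReal.ofReal t < G x then ENNReal.ofReal (t ^ (q - 1)) else 0) :=
          lintegral_lintegral_swap hm1.aemeasurable
      _ = ∫⁻ t in Ioi (0 : ℝ),
          ENNReal.ofReal (t ^ (q - 1)) * volume {x | M * ENNReal.ofReal t < lriesz b g x} := by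
          refine lintegral_congr fun t ↦ ?_
          have hset : {x | M * ENNReal.ofReal t < lriesz b g x} = {x | ENNReal.ofReal t < G x} := by
            ext x
            simp only [mem_ofPred_eq, hJG, ENNReal.mul_lt_mul_iff_right hM0 hMt]
          rw [hset, ← lintegral_indicator_const (measurableSet_lt measurable_const hGm)]
          simp [indicator]
      _ ≤ ∫⁻ t in Ioi (0 : ℝ), c₁ * ∫⁻ y,
          (if ENNReal.ofReal (t ^ (q / p)) < g y then g y else 0) *
            ENNReal.ofReal (t ^ (d - 1)) := by
          refine setLIntegral_mono' measurableSet_Ioi fun t (ht : 0 < t) ↦ ?_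
          refine (mul_le_mul' le_rfl
            (volume_lt_lriesz_le hn hpp hb hbn hq hpq hg hg1 hc₁ hc₂ ht)).trans (le_of_eq ?_)
          rw [lintegral_mul_const _ (Measurable.ite (measurableSet_lt measurable_const hg) hg
            measurable_const), hd, show q - q / p - 1 = (q - 1) + -(q / p) by ring,
            Real.rpow_add ht, ENNReal.ofReal_mul (by positivity)]
          ring
      _ = c₁ * ∫⁻ y, ∫⁻ t in Ioi (0 : ℝ),
          (if ENNReal.ofReal (t ^ (q / p)) < g y then g y else 0) *
            ENNReal.ofReal (t ^ (d - 1)) := by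
          rw [lintegral_const_mul _ hm2.lintegral_prod_right',
            lintegral_lintegral_swap hm2.aemeasurable]
      _ = c₁ * ∫⁻ y, g y ^ p * ENNReal.ofReal (1 / d) := by
          congr 1
          refine lintegral_congr fun y ↦ ?_
          calc _ = ∫⁻ t in Ioi (0 : ℝ), g y * (if ENNReal.ofReal t < g y ^ (p / q) then
                ENNReal.ofReal (t ^ (d - 1)) else 0) := by
                refine setLIntegral_congr_fun measurableSet_Ioi fun t (ht : 0 < t) ↦ ?_
                have : ENNReal.ofReal (t ^ (q / p)) < g y ↔
                    ENNReal.ofReal t < g y ^ (p / q) := by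
                  rw [← ENNReal.ofReal_rpow_of_pos ht, ← inv_div q p,
                    ENNReal.lt_rpow_inv_iff (div_pos hq hp)]
                simp only [this]
                split_ifs <;> simp
            _ = g y * ((g y ^ (p / q)) ^ d * ENNReal.ofReal (1 / d)) := by
                rw [lintegral_const_mul _ (Measurable.ite
                  (measurableSet_lt (by fun_prop) measurable_const) (by fun_prop) (by fun_prop)),
                  lintegral_Ioi_ite_rpow hd0]
            _ = _ := by
                have h5 : p / q * d = p - 1 := by rw [hd]; field_simp
                rw [← ENNReal.rpow_mul, h5, ← mul_assoc]
                nth_rewrite 1 [← ENNReal.rpow_one (g y)]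
                rw [← ENNReal.rpow_add_of_nonneg _ _ (by norm_num) (by linarith)]
                ring_nf
      _ ≤ c₁ * (1 * ENNReal.ofReal (1 / d)) := by
          rw [lintegral_mul_const _ (by fun_prop)]
          gcongr
      _ = _ := by rw [one_mul]
  calc ∫⁻ x, lriesz b g x ^ q
      = M ^ q * (ENNReal.ofReal q * ∫⁻ x, G x ^ q * ENNReal.ofReal (1 / q)) := by
        rw [lintegral_mul_const _ (by fun_prop), mul_left_comm (ENNReal.ofReal q), hq', mul_one,
          ← lintegral_const_mul _ (by fun_prop)]
        simp only [hJG, ENNReal.mul_rpow_of_nonneg _ _ hq.le]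
    _ ≤ _ := by gcongr

/-- Hardy–Littlewood–Sobolev inequality. -/
lemma lintegral_lriesz_rpow_le {n : ℕ} (hn : n ≠ 0) {b p q : ℝ}
    (hp1 : 1 < p) (hb : 0 < b) (hbn : b < n) (hq : 0 < q)
    (hpq : 1 / q = 1 / p - (n - b) / n) :
    ∃ C : ℝ≥0∞, C ≠ ∞ ∧ ∀ g : Eu n → ℝ≥0∞, Measurable g → ∀ N : ℝ≥0∞, N ≠ 0 → N ≠ ∞ →
      ∫⁻ y, g y ^ p ≤ N ^ p → (∫⁻ x, lriesz b g x ^ q) ^ (1 / q) ≤ C * N := by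
  obtain ⟨C, hC, h⟩ := lintegral_lriesz_rpow_le_of_le_one hn hp1 hb hbn hq hpq
  refine ⟨C ^ (1 / q), ENNReal.rpow_ne_top_of_nonneg (by positivity) hC,
    fun g hg N hN0 hNt hgN ↦ ?_⟩
  have hp : 0 < p := by linarith
  have h1 : ∫⁻ y, (N⁻¹ * g y) ^ p ≤ 1 := by
    simp only [ENNReal.mul_rpow_of_nonneg _ _ hp.le]
    rw [lintegral_const_mul _ (by fun_prop)]
    calc _ ≤ N⁻¹ ^ p * N ^ p := by gcongr
      _ = 1 := by
        rw [← ENNReal.mul_rpow_of_nonneg _ _ hp.le, ENNReal.inv_mul_cancel hN0 hNt,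
          ENNReal.one_rpow]
  have h2 (x : Eu n) : lriesz b g x = N * lriesz b (fun y ↦ N⁻¹ * g y) x := by
    simp only [lriesz, mul_assoc]
    rw [lintegral_const_mul _ (by fun_prop), ← mul_assoc, ENNReal.mul_inv_cancel hN0 hNt, one_mul]
  calc _ = (N ^ q * ∫⁻ x, lriesz b (fun y ↦ N⁻¹ * g y) x ^ q) ^ (1 / q) := by
        rw [← lintegral_const_mul _ ((measurable_lriesz b (hg.const_mul _)).pow_const q)]
        simp only [h2, ENNReal.mul_rpow_of_nonneg _ _ hq.le]
    _ ≤ (N ^ q * C) ^ (1 / q) := by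
        gcongr
        exact h _ (hg.const_mul _) h1
    _ = _ := by
        rw [ENNReal.mul_rpow_of_nonneg _ _ (by positivity), ← ENNReal.rpow_mul,
          mul_one_div_cancel hq.ne', ENNReal.rpow_one, mul_comm]

lemma setLIntegral_le_of_rpow_le {n : ℕ} {p lam : ℝ} (hp1 : 1 < p) {g : Eu n → ℝ≥0∞}
    (hg : Measurable g) {B : Set (Eu n)} (hB : volume B ≠ 0) (hB' : volume B ≠ ∞) {N : ℝ≥0∞}
    (h : ∫⁻ y in B, g y ^ p ≤ N ^ p * volume B ^ lam) :
    ∫⁻ y in B, g y ≤ N * volume B ^ (lam / p + 1 - 1 / p) := by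
  have hp : 0 < p := by linarith
  have hpp := Real.HolderConjugate.conjExponent hp1
  set p' := p.conjExponent
  have hpinv : 1 / p' = 1 - 1 / p := by
    have := hpp.inv_add_inv_eq_one
    simp only [one_div]
    linarith
  calc ∫⁻ y in B, g y = ∫⁻ y in B, (g * 1) y := by simp
    _ ≤ (∫⁻ y in B, g y ^ p) ^ (1 / p) * (∫⁻ y in B, (1 : Eu n → ℝ≥0∞) y ^ p') ^ (1 / p') :=
        ENNReal.lintegral_mul_le_Lp_mul_Lq _ hpp hg.aemeasurable aemeasurable_const
    _ ≤ (N ^ p * volume B ^ lam) ^ (1 / p) * volume B ^ (1 / p') := by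
        gcongr
        · exact hpp.symm.one_div_nonneg
        · simp
    _ = N * volume B ^ (lam / p + 1 - 1 / p) := by
        rw [ENNReal.mul_rpow_of_nonneg _ _ (by positivity), ← ENNReal.rpow_mul,
          mul_one_div_cancel hp.ne', ENNReal.rpow_one, ← ENNReal.rpow_mul, mul_assoc,
          ← ENNReal.rpow_add _ _ hB hB', hpinv, mul_one_div, add_sub_assoc]

lemma lriesz_compl_ball_le {n : ℕ} {b c r : ℝ} (hb : 0 < b) (hcb : c < b) (hr : 0 < r)
    {g : Eu n → ℝ≥0∞} (hg : Measurable g) {A : ℝ≥0∞}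
    (hA : ∀ t, 0 < t → ∫⁻ y in ball (0 : Eu n) t, g y ≤ A * ENNReal.ofReal (t ^ c))
    {x : Eu n} (hx : x ∈ ball (0 : Eu n) r) :
    lriesz b ((ball (0 : Eu n) (2 * r))ᶜ.indicator g) x ≤
      ENNReal.ofReal (2 ^ b) * (A * ENNReal.ofReal (b / (b - c) * (2 * r) ^ (c - b))) := by
  have hS : MeasurableSet (ball (0 : Eu n) (2 * r))ᶜ := measurableSet_ball.compl
  have h2r : 0 < 2 * r := by positivity
  rw [mem_ball_zero_iff] at hx
  calc _ = ∫⁻ y in (ball (0 : Eu n) (2 * r))ᶜ, g y * ENNReal.ofReal (‖x - y‖ ^ (-b)) := by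
        rw [lriesz, ← lintegral_indicator hS]
        simp only [indicator_mul_left]
    _ ≤ ∫⁻ y in (ball (0 : Eu n) (2 * r))ᶜ,
          ENNReal.ofReal (2 ^ b) * (g y * ENNReal.ofReal (‖y‖ ^ (-b))) := by
        refine setLIntegral_mono' hS fun y hy ↦ ?_
        have hy' : 2 * r ≤ ‖y‖ := by simpa using hy
        have hxy : ‖y‖ / 2 ≤ ‖x - y‖ := by
          have := norm_sub_norm_le y x
          rw [norm_sub_rev] at this
          linarith
        rw [mul_left_comm, ← ENNReal.ofReal_mul (by positivity)]
        gcongr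
        calc ‖x - y‖ ^ (-b) ≤ (‖y‖ / 2) ^ (-b) :=
              Real.rpow_le_rpow_of_nonpos (by linarith) hxy (by linarith)
          _ = 2 ^ b * ‖y‖ ^ (-b) := by
              rw [Real.div_rpow (norm_nonneg _) (by norm_num), Real.rpow_neg zero_le_two,
                div_inv_eq_mul, mul_comm]
    _ ≤ _ := by
        rw [lintegral_const_mul _ (by fun_prop)]
        gcongr
        exact setLIntegral_compl_ball_mul_norm_rpow_neg_le hb hcb h2r hg
          fun t ht ↦ hA t (h2r.trans ht)

lemma lriesz_indicator_add_compl {n : ℕ} (b : ℝ) {g : Eu n → ℝ≥0∞} (hg : Measurable g)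
    {S : Set (Eu n)} (hS : MeasurableSet S) (x : Eu n) :
    lriesz b g x = lriesz b (S.indicator g) x + lriesz b (Sᶜ.indicator g) x := by
  have hS' := hg.indicator hS
  simp only [lriesz]
  rw [← lintegral_add_left (by fun_prop)]
  refine lintegral_congr fun y ↦ ?_
  rw [← add_mul, indicator_self_add_compl_apply]

/-- The Spanne–Peetre inequality for nonnegative functions. -/
lemma lriesz_central_morrey_le {n : ℕ} (hn : n ≠ 0) {b p q lam : ℝ}
    (hp1 : 1 < p) (hb : 0 < b) (hbn : b < n) (hq : 1 ≤ q) (hlam : 0 ≤ lam)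
    (hpq : 1 / q = 1 / p - (n - b) / n) (hc : n * (lam / p + 1 - 1 / p) < b) :
    ∃ C : ℝ≥0∞, C ≠ ∞ ∧ ∀ g : Eu n → ℝ≥0∞, Measurable g → ∀ N : ℝ≥0∞, N ≠ 0 → N ≠ ∞ →
      (∀ r, 0 < r → ∫⁻ y in ball (0 : Eu n) r, g y ^ p ≤
        N ^ p * volume (ball (0 : Eu n) r) ^ lam) →
      ∀ r, 0 < r → volume (ball (0 : Eu n) r) ^ (-(lam / p)) *
        (∫⁻ x in ball (0 : Eu n) r, lriesz b g x ^ q) ^ (1 / q) ≤ C * N := by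
  have hq0 : 0 < q := by linarith
  have hp : 0 < p := by linarith
  have hn0 : (0 : ℝ) < n := hb.trans hbn
  obtain ⟨C₀, hC₀, hHLS⟩ := lintegral_lriesz_rpow_le hn hp1 hb hbn hq0 hpq
  set v := volume (ball (0 : Eu n) 1) with hv
  have hv0 : v ≠ 0 := (measure_ball_pos _ _ one_pos).ne'
  have hvt : v ≠ ∞ := measure_ball_lt_top.ne
  set κ := lam / p + 1 - 1 / p with hκ
  set l := lam / p with hl
  have hl0 : 0 ≤ l := by positivity
  set e := ENNReal.ofReal ((2 : ℝ) ^ (n : ℝ)) with he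
  set C₂ := ENNReal.ofReal (2 ^ b) * (v ^ κ * (ENNReal.ofReal (b / (b - n * κ)) *
    ENNReal.ofReal (2 ^ (n * κ - b)))) * v ^ (1 / q) * v ^ (-l) with hC₂
  have hvpow (t : ℝ) : v ^ t ≠ ∞ := ENNReal.rpow_ne_top_of_ne_zero hv0 hvt
  refine ⟨C₀ * e ^ l + C₂, ?_, fun g hg N hN0 hNt hgN r hr ↦ ?_⟩
  · have hel : e ^ l ≠ ∞ := ENNReal.rpow_ne_top_of_nonneg hl0 ENNReal.ofReal_ne_top
    finiteness
  have hdiff : 0 < b - n * κ := sub_pos.2 hc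
  set ρ := ENNReal.ofReal (r ^ (n : ℝ)) with hρ
  have hρ0 : ρ ≠ 0 := by simpa [hρ] using pow_pos hr n
  have hρt : ρ ≠ ∞ := ENNReal.ofReal_ne_top
  have hVr : volume (ball (0 : Eu n) r) = v * ρ := volume_ball_eu hn hr.le
  have hV2r : volume (ball (0 : Eu n) (2 * r)) = e * (v * ρ) := by
    rw [volume_ball_eu hn (by positivity), Real.mul_rpow (by norm_num) hr.le,
      ENNReal.ofReal_mul (by positivity), mul_left_comm]
  have hV0 : v * ρ ≠ 0 := mul_ne_zero hv0 hρ0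
  have hVt : v * ρ ≠ ∞ := ENNReal.mul_ne_top hvt hρt
  set B := ball (0 : Eu n) r
  set B₂ := ball (0 : Eu n) (2 * r)
  have hB₂ : MeasurableSet B₂ := measurableSet_ball
  set D := ENNReal.ofReal (2 ^ b) *
    (N * v ^ κ * ENNReal.ofReal (b / (b - n * κ) * (2 * r) ^ (n * κ - b))) with hD
  have hA (t : ℝ) (ht : 0 < t) :
      ∫⁻ y in ball (0 : Eu n) t, g y ≤ N * v ^ κ * ENNReal.ofReal (t ^ (n * κ)) := by
    refine (setLIntegral_le_of_rpow_le hp1 hg (measure_ball_pos _ _ ht).ne'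
      measure_ball_lt_top.ne (hgN t ht)).trans_eq ?_
    rw [volume_ball_eu hn ht.le, ENNReal.mul_rpow_of_ne_top hvt ENNReal.ofReal_ne_top,
      ENNReal.ofReal_rpow_of_pos (by positivity), ← Real.rpow_mul ht.le, mul_assoc]
  have hlocal : (∫⁻ x in B, lriesz b (B₂.indicator g) x ^ q) ^ (1 / q) ≤
      C₀ * (N * (e * (v * ρ)) ^ l) := by
    refine le_trans ?_ (hHLS (B₂.indicator g) (hg.indicator hB₂) _ (mul_ne_zero hN0 ?_)
      (ENNReal.mul_ne_top hNt ?_) ?_)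
    · gcongr
      exact Measure.restrict_le_self
    · rw [← hV2r]
      exact (ENNReal.rpow_pos (measure_ball_pos _ _ (by positivity)) measure_ball_lt_top.ne).ne'
    · exact ENNReal.rpow_ne_top_of_nonneg hl0 (ENNReal.mul_ne_top ENNReal.ofReal_ne_top hVt)
    · calc ∫⁻ y, B₂.indicator g y ^ p = ∫⁻ y in B₂, g y ^ p := by
            rw [← lintegral_indicator hB₂]
            refine lintegral_congr fun y ↦ ?_
            by_cases hy : y ∈ B₂ <;> simp [hy, hp]
        _ ≤ N ^ p * volume B₂ ^ lam := hgN _ (by positivity)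
        _ = _ := by
            rw [ENNReal.mul_rpow_of_nonneg _ _ hp.le, ← ENNReal.rpow_mul, hV2r, hl,
              div_mul_cancel₀ _ hp.ne']
  have hexp : n * κ - b = n * (l - 1 / q) := by
    rw [hpq, hκ]
    field_simp
    ring
  have hDeq : D = N * (ENNReal.ofReal (2 ^ b) * (v ^ κ * (ENNReal.ofReal (b / (b - n * κ)) *
      ENNReal.ofReal (2 ^ (n * κ - b))))) * ρ ^ (l - 1 / q) := by
    rw [hD, Real.mul_rpow (by norm_num) hr.le, ENNReal.ofReal_mul (by positivity),
      ENNReal.ofReal_mul (by positivity), hρ, ENNReal.ofReal_rpow_of_pos (by positivity),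
      ← Real.rpow_mul hr.le, hexp]
    ring
  have hmain : (∫⁻ x in B, lriesz b g x ^ q) ^ (1 / q) ≤
      C₀ * (N * (e * (v * ρ)) ^ l) + D * (v * ρ) ^ (1 / q) := by
    calc _ ≤ (∫⁻ x in B, (lriesz b (B₂.indicator g) + fun _ : Eu n ↦ D : Eu n → ℝ≥0∞) x ^ q) ^ (1 / q) := by
          refine ENNReal.rpow_le_rpow (setLIntegral_mono' measurableSet_ball fun x hx ↦ ?_)
            (by positivity)
          rw [lriesz_indicator_add_compl b hg hB₂, Pi.add_apply]
          gcongr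
          exact lriesz_compl_ball_le hb hc hr hg hA hx
      _ ≤ (∫⁻ x in B, lriesz b (B₂.indicator g) x ^ q) ^ (1 / q) +
            (∫⁻ _ in B, D ^ q) ^ (1 / q) :=
          ENNReal.lintegral_Lp_add_le (measurable_lriesz b (hg.indicator hB₂)).aemeasurable
            aemeasurable_const hq
      _ ≤ _ := by
          gcongr
          rw [setLIntegral_const, ENNReal.mul_rpow_of_nonneg _ _ (by positivity),
            ← ENNReal.rpow_mul, mul_one_div_cancel hq0.ne', ENNReal.rpow_one, hVr]
  have hcancel (z : ℝ≥0∞) (h0 : z ≠ 0) (ht : z ≠ ∞) (a : ℝ) : z ^ (-a) * z ^ a = 1 := by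
    rw [← ENNReal.rpow_add _ _ h0 ht, neg_add_cancel, ENNReal.rpow_zero]
  have hρ1 : ρ ^ (-l) * (ρ ^ (l - 1 / q) * ρ ^ (1 / q)) = 1 := by
    rw [← ENNReal.rpow_add _ _ hρ0 hρt, sub_add_cancel, hcancel ρ hρ0 hρt]
  calc _ ≤ (v * ρ) ^ (-l) * (C₀ * (N * (e * (v * ρ)) ^ l) + D * (v * ρ) ^ (1 / q)) := by
        rw [hVr]
        gcongr
    _ = C₀ * e ^ l * N * ((v * ρ) ^ (-l) * (v * ρ) ^ l) +
          C₂ * N * (ρ ^ (-l) * (ρ ^ (l - 1 / q) * ρ ^ (1 / q))) := by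
        rw [hDeq, hC₂, ENNReal.mul_rpow_of_nonneg e _ hl0, ENNReal.mul_rpow_of_ne_top hvt hρt (-l),
          ENNReal.mul_rpow_of_ne_top hvt hρt (1 / q)]
        ring
    _ = _ := by
        rw [hcancel _ hV0 hVt, hρ1]
        ring

lemma enorm_riesz_le_lriesz {n : ℕ} (α : ℝ) {f : Eu n → ℝ} {g : Eu n → ℝ≥0∞}
    (hfg : ∀ᵐ y, ‖f y‖ₑ = g y) (x : Eu n) :
    ‖riesz α f x‖ₑ ≤ lriesz ((n : ℝ) - α) g x := by
  refine (enorm_integral_le_lintegral_enorm _).trans_eq (lintegral_congr_ae ?_)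
  filter_upwards [hfg] with y hy
  rw [div_eq_mul_inv, enorm_mul, hy, ← Real.rpow_neg (norm_nonneg _),
    Real.enorm_eq_ofReal (by positivity)]

/-- Spanne–Peetre type boundedness of the Riesz potential on central Morrey spaces. -/
theorem statement18 {n : ℕ} (α : ℝ) (hα : 0 < α) (hαn : α < n)
    (lam : ℝ) (hlam0 : 0 ≤ lam) (hlam1 : lam < 1)
    (p q mu : ℝ) (hp1 : 1 < p) (hp2 : p < n * (1 - lam) / α)
    (hq : 1 / q = 1 / p - α / n) (hmu : lam / p = mu / q) :
    ∃ C : ℝ, 1 ≤ C ∧ ∀ f : Eu n → ℝ, LocallyIntegrable f volume → centralNormP p lam f ≠ ∞ →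
      centralNormP q mu (riesz α f) ≤ ENNReal.ofReal C * centralNormP p lam f := by
  have hn0 : (0 : ℝ) < n := hα.trans hαn
  have hn : n ≠ 0 := by exact_mod_cast hn0.ne'
  have hp : 0 < p := by linarith
  have hp2' : p * α < n * (1 - lam) := (lt_div_iff₀ hα).1 hp2
  have hqpos : 0 < q := by
    have h1 : α / n < 1 / p := by
      rw [div_lt_div_iff₀ hn0 hp]
      nlinarith
    exact one_div_pos.1 (by linarith)
  have hq1 : 1 ≤ q := by
    have h1 : 1 / p < 1 := (div_lt_one hp).2 hp1
    have h2 : 0 < α / n := by positivity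
    have h3 : 1 / q < 1 := by linarith
    exact ((div_lt_one hqpos).1 h3).le
  have hc : n * (lam / p + 1 - 1 / p) < n - α := by
    have h1 : α < n * (1 - lam) / p := by rw [lt_div_iff₀ hp]; linarith
    have h2 : n * (lam / p + 1 - 1 / p) = n - n * (1 - lam) / p := by
      field_simp
      ring
    linarith
  obtain ⟨C, hC, h⟩ := lriesz_central_morrey_le hn hp1 (sub_pos.2 hαn) (sub_lt_self _ hα) hq1
    hlam0 (by rw [hq, sub_sub_cancel (n : ℝ)]) hc
  set C' := max 1 C.toReal with hC'
  have hC'1 : 1 ≤ C' := le_max_left _ _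
  have hCC' : C ≤ ENNReal.ofReal C' :=
    (ENNReal.le_ofReal_iff_toReal_le hC (by positivity)).2 (le_max_right _ _)
  have hC'0 : ENNReal.ofReal C' ≠ 0 := by simpa using zero_lt_one.trans_le hC'1
  refine ⟨C', hC'1, fun f hf hX ↦ ?_⟩
  set X := centralNormP p lam f with hXdef
  set g : Eu n → ℝ≥0∞ := fun y ↦ ‖hf.aestronglyMeasurable.mk f y‖ₑ
  have hg : Measurable g := hf.aestronglyMeasurable.stronglyMeasurable_mk.measurable.enorm
  have hfg : ∀ᵐ y, ‖f y‖ₑ = g y := by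
    filter_upwards [hf.aestronglyMeasurable.ae_eq_mk] with y hy
    rw [hy]
  refine ENNReal.le_of_forall_pos_le_add fun ε hε _ ↦ ?_
  set N : ℝ≥0∞ := X + ε / ENNReal.ofReal C' with hN
  have hN0 : N ≠ 0 := by
    simp [hN, hε.ne']
  have hNt : N ≠ ∞ := ENNReal.add_ne_top.2 ⟨hX, ENNReal.div_ne_top ENNReal.coe_ne_top hC'0⟩
  have hgN (r : ℝ) (hr : 0 < r) : ∫⁻ y in ball (0 : Eu n) r, g y ^ p ≤
      N ^ p * volume (ball (0 : Eu n) r) ^ lam := by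
    set V := volume (ball (0 : Eu n) r) with hV
    have hV0 : V ≠ 0 := (measure_ball_pos _ _ hr).ne'
    have hVt : V ≠ ∞ := measure_ball_lt_top.ne
    have h1 : (V ^ (-lam) * ∫⁻ x in ball (0 : Eu n) r, (‖f x‖₊ : ℝ≥0∞) ^ p) ^ (1 / p) ≤ N :=
      (le_iSup₂ (f := fun (r : ℝ) (_ : 0 < r) ↦ (volume (ball (0 : Eu n) r) ^ (-lam) *
        ∫⁻ x in ball (0 : Eu n) r, (‖f x‖₊ : ℝ≥0∞) ^ p) ^ (1 / p)) r hr).trans le_self_add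
    have h2 : ∫⁻ x in ball (0 : Eu n) r, (‖f x‖₊ : ℝ≥0∞) ^ p =
        ∫⁻ y in ball (0 : Eu n) r, g y ^ p := by
      refine lintegral_congr_ae (ae_restrict_of_ae ?_)
      filter_upwards [hfg] with y hy
      rw [← hy]
      rfl
    rw [h2, one_div, ENNReal.rpow_inv_le_iff hp] at h1
    calc _ = V ^ (-lam) * (∫⁻ y in ball (0 : Eu n) r, g y ^ p) * V ^ lam := by
          rw [mul_right_comm, ← ENNReal.rpow_add _ _ hV0 hVt, neg_add_cancel, ENNReal.rpow_zero,
            one_mul]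
      _ ≤ _ := by gcongr
  calc centralNormP q mu (riesz α f) ≤ ENNReal.ofReal C' * N := by
        refine iSup₂_le fun r hr ↦ ?_
        refine le_trans ?_ ((h g hg N hN0 hNt hgN r hr).trans (mul_le_mul' hCC' le_rfl))
        rw [ENNReal.mul_rpow_of_nonneg _ _ (by positivity), ← ENNReal.rpow_mul, neg_mul,
          mul_one_div, ← hmu]
        gcongr with x
        exact enorm_riesz_le_lriesz α hfg x
    _ = _ := by
        rw [hN, mul_add, ENNReal.mul_div_cancel hC'0 ENNReal.ofReal_ne_top]
end
end

section
/- Let 1 ≤ p < ∞ and define f: ℝ → ℝ by f(x) = Σ_{n=0}^{∞} 2^{n/p} χ_{[n, n+2^{-n}]}(|x|). Then f belongs to the central Morrey space M^{p,1}(0) on ℝ but f ∉ L^∞(ℝ); in particular the embedding L^∞(ℝ) ⊂ M^{p,1}(0) is strict. -/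
open MeasureTheory Metric Set Filter ENNReal NNReal Topology

noncomputable section

/-- The set `{x : |x| ∈ [k, k + 2⁻ᵏ]}` on which the `k`-th spike lives. -/
def spikeSet (k : ℕ) : Set ℝ := (fun x : ℝ => |x|) ⁻¹' Icc (k : ℝ) ((k : ℝ) + 2 ^ (-(k : ℝ)))

lemma measurableSet_spikeSet (k : ℕ) : MeasurableSet (spikeSet k) :=
  measurableSet_Icc.preimage continuous_abs.measurable

lemma two_rpow_neg_natCast_le_one (k : ℕ) : (2 : ℝ) ^ (-(k : ℝ)) ≤ 1 :=
  Real.rpow_le_one_of_one_le_of_nonpos one_le_two (by simp)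

lemma two_pow_mul_volume_spikeSet_le (k : ℕ) : (2 : ℝ≥0∞) ^ k * volume (spikeSet k) ≤ 2 := by
  have hsub : spikeSet k ⊆
      Icc (k : ℝ) (k + 2 ^ (-(k : ℝ))) ∪ Icc (-(k + 2 ^ (-(k : ℝ)))) (-(k : ℝ)) := by
    rintro x ⟨h1, h2⟩
    rcases abs_cases x with ⟨h, _⟩ | ⟨h, _⟩ <;> simp only [h] at h1 h2
    · exact Or.inl ⟨h1, h2⟩
    · exact Or.inr ⟨by linarith, by linarith⟩
  have hpow : ENNReal.ofReal ((2 : ℝ) ^ (-(k : ℝ))) = ((2 : ℝ≥0∞) ^ k)⁻¹ := by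
    rw [Real.rpow_neg two_pos.le, Real.rpow_natCast, ENNReal.ofReal_inv_of_pos (by positivity),
      ENNReal.ofReal_pow two_pos.le, ENNReal.ofReal_ofNat]
  have hvol : volume (spikeSet k) ≤ ((2 : ℝ≥0∞) ^ k)⁻¹ + ((2 : ℝ≥0∞) ^ k)⁻¹ := by
    refine (measure_mono hsub).trans ((measure_union_le _ _).trans_eq ?_)
    rw [Real.volume_Icc, Real.volume_Icc, ← hpow]
    congr 2 <;> ring
  calc (2 : ℝ≥0∞) ^ k * volume (spikeSet k)
      ≤ (2 : ℝ≥0∞) ^ k * (((2 : ℝ≥0∞) ^ k)⁻¹ + ((2 : ℝ≥0∞) ^ k)⁻¹) := by gcongr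
    _ = 2 := by
      rw [mul_add, ENNReal.mul_inv_cancel (by simp) (by simp), one_add_one_eq_two]

/-- Away from the integers at most one spike, the one of index `⌊t⌋₊`, contributes. -/
lemma tsum_spike_eq (p : ℝ) {t : ℝ} (ht : ∀ k : ℕ, t ≠ k) :
    ∑' k : ℕ, (2 : ℝ) ^ ((k : ℝ) / p) *
        (Icc (k : ℝ) ((k : ℝ) + 2 ^ (-(k : ℝ)))).indicator (1 : ℝ → ℝ) t =
      (2 : ℝ) ^ ((⌊t⌋₊ : ℝ) / p) *
        (Icc (⌊t⌋₊ : ℝ) ((⌊t⌋₊ : ℝ) + 2 ^ (-(⌊t⌋₊ : ℝ)))).indicator (1 : ℝ → ℝ) t := by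
  refine tsum_eq_single ⌊t⌋₊ fun k hk => ?_
  rw [indicator_of_notMem, mul_zero]
  rintro ⟨h1, h2⟩
  refine hk ((Nat.floor_eq_iff (k.cast_nonneg.trans h1)).2 ⟨h1, ?_⟩).symm
  have hne := ht (k + 1)
  push_cast at hne
  exact lt_of_le_of_ne (h2.trans (by linarith [two_rpow_neg_natCast_le_one k])) hne

lemma ae_abs_ne_natCast : ∀ᵐ x : ℝ, ∀ k : ℕ, |x| ≠ k := by
  filter_upwards [(countable_range ((↑) : ℤ → ℝ)).ae_notMem volume] with x hx k hk
  rcases abs_cases x with ⟨h, _⟩ | ⟨h, _⟩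
  · exact hx ⟨k, by push_cast; linarith⟩
  · exact hx ⟨-k, by push_cast; linarith⟩

/-- an unbounded function in the central Morrey space `M^{p,1}(0)` on `ℝ`. -/
theorem statement19 (p : ℝ) (hp : 1 ≤ p) (f : ℝ → ℝ)
    (hf : ∀ x : ℝ, f x =
      ∑' k : ℕ, (2 : ℝ) ^ ((k : ℝ) / p) *
        (Set.Icc (k : ℝ) ((k : ℝ) + 2 ^ (-(k : ℝ)))).indicator (1 : ℝ → ℝ) |x|) :
    (LocallyIntegrable f volume ∧
      (⨆ (r : ℝ) (_ : 0 < r),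
        (volume (ball (0 : ℝ) r) ^ (-(1 : ℝ)) *
          ∫⁻ x in ball (0 : ℝ) r, (‖f x‖₊ : ℝ≥0∞) ^ p) ^ (1 / p)) ≠ ∞) ∧
    ¬ ∃ C : ℝ, ∀ᵐ x : ℝ ∂volume, |f x| ≤ C := by
  have hp0 : 0 < p := by linarith
  have hfae : ∀ᵐ x : ℝ, f x = (2 : ℝ) ^ ((⌊|x|⌋₊ : ℝ) / p) *
      (Icc (⌊|x|⌋₊ : ℝ) ((⌊|x|⌋₊ : ℝ) + 2 ^ (-(⌊|x|⌋₊ : ℝ)))).indicator (1 : ℝ → ℝ) |x| := by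
    filter_upwards [ae_abs_ne_natCast] with x hx
    rw [hf, tsum_spike_eq p hx]
  have hmeas : Measurable f := by
    rw [funext hf]
    refine Measurable.tsum fun k => Measurable.const_mul ?_ _
    exact (measurable_one.indicator measurableSet_Icc).comp continuous_abs.measurable
  have hlint (r : ℝ) (hr : 0 < r) :
      ∫⁻ x in ball (0 : ℝ) r, (‖f x‖₊ : ℝ≥0∞) ^ p ≤ 2 * volume (ball (0 : ℝ) r) := by
    have hbound : ∀ᵐ x ∂volume.restrict (ball (0 : ℝ) r), (‖f x‖₊ : ℝ≥0∞) ^ p ≤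
        ∑ k ∈ Finset.range (⌊r⌋₊ + 1), (spikeSet k).indicator (fun _ => (2 : ℝ≥0∞) ^ k) x := by
      filter_upwards [ae_restrict_of_ae hfae, ae_restrict_mem measurableSet_ball] with x hx hxr
      rw [mem_ball_zero_iff, Real.norm_eq_abs] at hxr
      by_cases hm : x ∈ spikeSet ⌊|x|⌋₊
      · rw [indicator_of_mem (show |x| ∈ Icc _ _ from hm), Pi.one_apply, mul_one] at hx
        have hpow : (‖f x‖₊ : ℝ≥0∞) ^ p = 2 ^ ⌊|x|⌋₊ := by
          rw [← enorm_eq_nnnorm, hx, Real.enorm_of_nonneg (by positivity),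
            ENNReal.ofReal_rpow_of_nonneg (by positivity) hp0.le, ← Real.rpow_mul two_pos.le,
            div_mul_cancel₀ _ hp0.ne', Real.rpow_natCast, ENNReal.ofReal_pow two_pos.le,
            ENNReal.ofReal_ofNat]
        rw [hpow]
        refine le_trans (indicator_of_mem hm (fun _ => (2 : ℝ≥0∞) ^ ⌊|x|⌋₊)).ge
          (Finset.single_le_sum
            (f := fun k => (spikeSet k).indicator (fun _ => (2 : ℝ≥0∞) ^ k) x)
            (fun _ _ => zero_le) ?_)
        exact Finset.mem_range.2 (Nat.lt_succ_of_le (Nat.floor_mono hxr.le))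
      · rw [indicator_of_notMem (show |x| ∉ Icc _ _ from hm), mul_zero] at hx
        simp [hx, hp0]
    calc ∫⁻ x in ball (0 : ℝ) r, (‖f x‖₊ : ℝ≥0∞) ^ p
        ≤ ∑ k ∈ Finset.range (⌊r⌋₊ + 1), 2 ^ k * volume (spikeSet k ∩ ball (0 : ℝ) r) := by
          refine (lintegral_mono_ae hbound).trans_eq ?_
          rw [lintegral_finsetSum _ fun k _ => measurable_const.indicator (measurableSet_spikeSet k)]
          refine Finset.sum_congr rfl fun k _ => ?_
          rw [lintegral_indicator_const (measurableSet_spikeSet k),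
            Measure.restrict_apply (measurableSet_spikeSet k)]
      _ ≤ ∑ _k ∈ Finset.range ⌊r⌋₊, 2 + volume (ball (0 : ℝ) r) := by
          rw [Finset.sum_range_succ']
          refine add_le_add (Finset.sum_le_sum fun k _ => ?_) ?_
          · exact (mul_le_mul_right (measure_mono inter_subset_left) _).trans
              (two_pow_mul_volume_spikeSet_le (k + 1))
          · rw [pow_zero, one_mul]
            exact measure_mono inter_subset_right
      _ ≤ 2 * volume (ball (0 : ℝ) r) := by
          rw [two_mul]
          gcongr
          rw [Finset.sum_const, Finset.card_range, nsmul_eq_mul, Real.volume_ball, mul_comm 2 r,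
            ENNReal.ofReal_mul hr.le, ENNReal.ofReal_ofNat, ← ENNReal.ofReal_natCast]
          gcongr
          exact Nat.floor_le hr.le
  refine ⟨⟨?_, ?_⟩, ?_⟩
  · have hcont : Continuous fun x : ℝ => (2 : ℝ) ^ (|x| / p) :=
      (Real.continuous_const_rpow two_ne_zero).comp (continuous_abs.div_const p)
    refine hcont.locallyIntegrable.mono hmeas.aestronglyMeasurable ?_
    filter_upwards [hfae] with x hx
    have hle : (2 : ℝ) ^ ((⌊|x|⌋₊ : ℝ) / p) ≤ (2 : ℝ) ^ (|x| / p) := by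
      gcongr
      · exact one_le_two
      · exact Nat.floor_le (abs_nonneg x)
    rw [hx, Real.norm_of_nonneg (by positivity : (0 : ℝ) ≤ 2 ^ (|x| / p)), norm_mul,
      Real.norm_of_nonneg (by positivity)]
    refine le_trans (mul_le_of_le_one_right (by positivity) ?_) hle
    exact (norm_indicator_le_norm_self _ _).trans (by simp)
  · refine ne_top_of_le_ne_top (b := (2 : ℝ≥0∞) ^ (1 / p)) (by simp) ?_
    refine iSup₂_le fun r hr => ENNReal.rpow_le_rpow ?_ (by positivity)
    have hv0 : volume (ball (0 : ℝ) r) ≠ 0 := (measure_ball_pos _ _ hr).ne'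
    rw [ENNReal.rpow_neg_one, mul_comm, ← div_eq_mul_inv]
    exact ENNReal.div_le_of_le_mul (hlint r hr)
  · rintro ⟨C, hC⟩
    obtain ⟨n, hn⟩ := pow_unbounded_of_one_lt C
      (Real.one_lt_rpow one_lt_two (by positivity : 0 < 1 / p))
    have hpow : (2 : ℝ) ^ ((n : ℝ) / p) = ((2 : ℝ) ^ (1 / p)) ^ n := by
      rw [← Real.rpow_natCast, ← Real.rpow_mul two_pos.le]
      congr 1
      ring
    have hnull : volume (Ioo (n : ℝ) (n + 2 ^ (-(n : ℝ)))) = 0 := by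
      refine measure_mono_null (fun x hx => ?_) (ae_iff.1 (hC.and hfae))
      rintro ⟨hxC, hfx⟩
      have hx0 : 0 ≤ x := n.cast_nonneg.trans hx.1.le
      have hfl : ⌊|x|⌋₊ = n := by
        rw [abs_of_nonneg hx0, Nat.floor_eq_iff hx0]
        exact ⟨hx.1.le, hx.2.trans_le (by linarith [two_rpow_neg_natCast_le_one n])⟩
      rw [hfl, abs_of_nonneg hx0, indicator_of_mem (Ioo_subset_Icc_self hx), Pi.one_apply, mul_one,
        hpow] at hfx
      rw [hfx] at hxC
      exact absurd hn (not_lt.2 ((le_abs_self _).trans hxC))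
    rw [Real.volume_Ioo, add_sub_cancel_left, ENNReal.ofReal_eq_zero] at hnull
    exact absurd hnull (not_le.2 (by positivity))
end
end
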